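/- arXiv:1707.07919 — 2 statements merged into one kernel-verified Lean document; each statement's English description precedes it below -/
import Mathlib

section
/- For every Markovian strategy ξ there exists exactly one arrival rate κ > 0 such that the unique probability solution π of the balance equations for (ξ,κ) satisfies ∑_{(z,n)∈S} n·π(z,n) = β; moreover this κ lies in the interval [β·λ·(1−γ), β·λ]. -/
open scoped BigOperators

variable {Z : Type}

/-- A Markovian strategy `ξ : S → [0,1]` on the state space `S = Z × ℕ`. -/
def IsStrategy (ξ : Z → ℕ → ℝ) : Prop := ∀ z n, 0 ≤ ξ z n ∧ ξ z n ≤ 1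

/-- The balance (stationarity) equations for the single-location chain `MC(ξ, κ)`. -/
def Balance [Fintype Z] [DecidableEq Z] (μ : Z → Z → ℝ) (lam γ κ : ℝ)
    (ξ : Z → ℕ → ℝ) (π : Z → ℕ → ℝ) : Prop :=
  ∀ x : Z, ∀ m : ℕ,
    π x m * ((∑ y ∈ Finset.univ.filter (fun y => y ≠ x), μ x y) + κ
        + lam * m * (1 - γ * ξ x m))
      = (∑ z ∈ Finset.univ.filter (fun z => z ≠ x), π z m * μ z x)
        + κ * (if 1 ≤ m then π x (m - 1) else 0)
        + lam * (m + 1) * (1 - γ * ξ x (m + 1)) * π x (m + 1)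

/-- A probability solution of the balance equations for `(ξ, κ)`. -/
def IsProbSolution [Fintype Z] [DecidableEq Z] (μ : Z → Z → ℝ) (lam γ κ : ℝ)
    (ξ : Z → ℕ → ℝ) (π : Z → ℕ → ℝ) : Prop :=
  (∀ z n, 0 ≤ π z n) ∧ Summable (fun p : Z × ℕ => π p.1 p.2) ∧
    (∑' p : Z × ℕ, π p.1 p.2) = 1 ∧ Balance μ lam γ κ ξ π

/-- A resource-sharing function: nonnegative, positive somewhere (with `n ≥ 1`),
and tending to `0` as the number of agents grows. -/
def IsResourceSharing (F : Z → ℕ → ℝ) : Prop :=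
  (∀ z n, 0 ≤ F z n) ∧ (∃ z₀ n₀, 1 ≤ n₀ ∧ 0 < F z₀ n₀) ∧
    ∀ z, Filter.Tendsto (fun n => F z n) Filter.atTop (nhds 0)

/-- A value-function pair `(V, V_st)` for `(ξ, κ, V_sw)`: the Bellman equations. -/
def IsValuePair [Fintype Z] [DecidableEq Z] (μ : Z → Z → ℝ) (lam γ κ V_sw : ℝ)
    (F ξ : Z → ℕ → ℝ) (V V_st : Z → ℕ → ℝ) : Prop :=
  (∃ M, ∀ z n, |V z n| ≤ M) ∧ (∃ M, ∀ z n, |V_st z n| ≤ M) ∧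
    ∀ z : Z, ∀ n : ℕ, 1 ≤ n →
      V z n = F z n + γ * max (V_st z n) V_sw ∧
      ((n : ℝ) * lam + κ + ∑ y ∈ Finset.univ.filter (fun y => y ≠ z), μ z y) * V_st z n
        = lam * V z n + κ * V_st z (n + 1)
          + (∑ w ∈ Finset.univ.filter (fun w => w ≠ z), μ z w * V_st w n)
          + ((n : ℝ) - 1) * lam * (1 - γ * ξ z n) * V_st z (n - 1)
          + ((n : ℝ) - 1) * lam * γ * ξ z n * V_st z n

/-- A mean field equilibrium `(ξ, κ, V_sw, π, V, V_st)`. -/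
def IsMFE [Fintype Z] [DecidableEq Z] (μ : Z → Z → ℝ) (lam γ β : ℝ) (F : Z → ℕ → ℝ)
    (ξ : Z → ℕ → ℝ) (κ V_sw : ℝ) (π V V_st : Z → ℕ → ℝ) : Prop :=
  IsStrategy ξ ∧ 0 < κ ∧ 0 < V_sw ∧
    IsProbSolution μ lam γ κ ξ π ∧
    IsValuePair μ lam γ κ V_sw F ξ V V_st ∧
    (∀ z : Z, ∀ n : ℕ, 1 ≤ n →
      (V_sw < V_st z n → ξ z n = 1) ∧ (V_st z n < V_sw → ξ z n = 0)) ∧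
    V_sw = (∑' p : Z × ℕ, π p.1 p.2 * V_st p.1 (p.2 + 1)) ∧
    (∑' p : Z × ℕ, (p.2 : ℝ) * π p.1 p.2) = β

/-- `Ψ = (1/λ) · max_{z ∈ Z} ∑_{y ≠ z} μ(z,y)`. -/
noncomputable def Psi [Fintype Z] [DecidableEq Z] [Nonempty Z]
    (μ : Z → Z → ℝ) (lam : ℝ) : ℝ :=
  (1 / lam) * Finset.univ.sup' Finset.univ_nonempty
    (fun z : Z => ∑ y ∈ Finset.univ.filter (fun y => y ≠ z), μ z y)

/-- Total exit rate of the environment from `x`. -/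
def qRate {Z : Type} [Fintype Z] [DecidableEq Z] (μ : Z → Z → ℝ) (x : Z) : ℝ :=
  ∑ y ∈ Finset.univ.filter (fun y => y ≠ x), μ x y

/-- Inflow from other environment states. -/
def inflow {Z : Type} [Fintype Z] [DecidableEq Z] (μ : Z → Z → ℝ) (f : Z → ℝ) (x : Z) : ℝ :=
  ∑ z ∈ Finset.univ.filter (fun z => z ≠ x), f z * μ z x

/-- Balance equation at a single state with general death rates `d`. -/
def BalAt {Z : Type} [Fintype Z] [DecidableEq Z] (μ : Z → Z → ℝ) (κ : ℝ)
    (d π : Z → ℕ → ℝ) (x : Z) (m : ℕ) : Prop :=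
  π x m * (qRate μ x + κ + d x m)
    = inflow μ (fun z => π z m) x + κ * (if 1 ≤ m then π x (m - 1) else 0)
      + d x (m + 1) * π x (m + 1)

lemma sum_inflow {Z : Type} [Fintype Z] [DecidableEq Z] (μ : Z → Z → ℝ) (f : Z → ℝ) :
    ∑ x, inflow μ f x = ∑ x, f x * qRate μ x := by
  unfold inflow qRate
  simp_rw [Finset.mul_sum, Finset.sum_filter]
  rw [Finset.sum_comm]
  refine Finset.sum_congr rfl fun x _ => Finset.sum_congr rfl fun y _ => ?_
  simp only [ne_comm]

lemma inflow_sub {Z : Type} [Fintype Z] [DecidableEq Z] (μ : Z → Z → ℝ) (f g : Z → ℝ) (x : Z) :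
    inflow μ (fun z => f z - g z) x = inflow μ f x - inflow μ g x := by
  unfold inflow
  rw [← Finset.sum_sub_distrib]
  exact Finset.sum_congr rfl fun z _ => by ring

lemma inflow_smul {Z : Type} [Fintype Z] [DecidableEq Z] (μ : Z → Z → ℝ) (c : ℝ) (f : Z → ℝ)
    (x : Z) : inflow μ (fun z => c * f z) x = c * inflow μ f x := by
  unfold inflow
  rw [Finset.mul_sum]
  exact Finset.sum_congr rfl fun z _ => by ring

lemma inflow_nonneg {Z : Type} [Fintype Z] [DecidableEq Z] {μ : Z → Z → ℝ}
    (hμ : ∀ z y : Z, z ≠ y → 0 < μ z y) {f : Z → ℝ} (hf : ∀ z, 0 ≤ f z) (x : Z) :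
    0 ≤ inflow μ f x := by
  refine Finset.sum_nonneg fun z hz => mul_nonneg (hf z) (hμ z x ?_).le
  simpa using hz

lemma cut_eq {Z : Type} [Fintype Z] [DecidableEq Z] {μ : Z → Z → ℝ} {κ : ℝ}
    {d π : Z → ℕ → ℝ} (hd0 : ∀ x, d x 0 = 0) (N : ℕ)
    (hb : ∀ x, ∀ m < N, BalAt μ κ d π x m) :
    ∀ m < N, κ * ∑ x, π x m = ∑ x, d x (m + 1) * π x (m + 1) := by
  intro m
  have key : ∀ m < N, κ * ∑ x, π x m + ∑ x, d x m * π x m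
      = κ * (if 1 ≤ m then ∑ x, π x (m - 1) else 0) + ∑ x, d x (m + 1) * π x (m + 1) := by
    intro m hm
    have h := Finset.sum_congr (rfl : (Finset.univ : Finset Z) = Finset.univ)
      (fun x _ => hb x m hm)
    simp only [Finset.sum_add_distrib, sum_inflow, mul_add] at h
    rw [← Finset.sum_mul, ← Finset.mul_sum] at h
    have h2 : ∑ x, (if 1 ≤ m then π x (m - 1) else 0)
        = (if 1 ≤ m then ∑ x, π x (m - 1) else 0) := by split_ifs <;> simp
    rw [h2] at h
    have h3 : ∑ x, π x m * d x m = ∑ x, d x m * π x m :=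
      Finset.sum_congr rfl fun x _ => mul_comm _ _
    linarith
  induction m with
  | zero =>
    intro hm
    have := key 0 hm
    simpa [hd0] using this
  | succ k ih =>
    intro hm
    have h1 := key (k + 1) hm
    have h2 := ih (by omega)
    simp at h1
    linarith

lemma level_bound {κ a : ℝ} (hκ : 0 < κ) (ha : 0 < a)
    {P : ℕ → ℝ} (hP0 : P 0 ≤ 1)
    (hstep : ∀ m : ℕ, a * (m + 1) * P (m + 1) ≤ κ * P m) (m : ℕ) :
    P m ≤ (κ / a) ^ m / (m.factorial : ℝ) := by
  induction m with
  | zero => simpa using hP0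
  | succ k ih =>
    have h1 := hstep k
    have h2 : P (k + 1) ≤ κ * P k / (a * (k + 1)) := by
      rw [le_div_iff₀ (by positivity)]; linarith
    refine h2.trans ?_
    rw [div_le_iff₀ (by positivity), Nat.factorial_succ]
    refine (mul_le_mul_of_nonneg_left ih hκ.le).trans (le_of_eq ?_)
    push_cast
    have : (k.factorial : ℝ) ≠ 0 := by positivity
    rw [pow_succ]
    field_simp

lemma summable_c {r : ℝ} : Summable (fun m : ℕ => r ^ m / (m.factorial : ℝ)) :=
  Real.summable_pow_div_factorial r

lemma summable_mc {r : ℝ} : Summable (fun m : ℕ => (m : ℝ) * (r ^ m / (m.factorial : ℝ))) := by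
  rw [← summable_nat_add_iff 1]
  refine (summable_c (r := r)).mul_left r |>.congr fun m => ?_
  rw [Nat.factorial_succ]
  push_cast
  have : (m.factorial : ℝ) ≠ 0 := by positivity
  rw [pow_succ]
  field_simp

lemma summable_prodc {Z : Type} [Fintype Z] {f : ℕ → ℝ} (hf : Summable f) (h0 : ∀ n, 0 ≤ f n) :
    Summable (fun p : Z × ℕ => f p.2) := by
  have := Summable.mul_of_nonneg (f := fun _ : Z => (1 : ℝ)) (Summable.of_finite) hf
    (fun _ => zero_le_one) h0
  simpa using this

lemma tsum_levels {Z : Type} [Fintype Z] {f : Z → ℕ → ℝ}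
    (hf : Summable (fun p : Z × ℕ => f p.1 p.2)) :
    (∀ x, Summable (f x)) ∧ (∑' p : Z × ℕ, f p.1 p.2 = ∑ x, ∑' n, f x n) ∧
      Summable (fun n => ∑ x, f x n) ∧ (∑' p : Z × ℕ, f p.1 p.2 = ∑' n, ∑ x, f x n) := by
  have h1 : ∀ x, Summable (f x) := fun x => hf.prod_factor x
  have h2 : ∑' p : Z × ℕ, f p.1 p.2 = ∑ x, ∑' n, f x n := by
    rw [hf.tsum_prod, tsum_fintype]
  refine ⟨h1, h2, summable_sum fun x _ => h1 x, ?_⟩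
  rw [h2, Summable.tsum_finsetSum fun x _ => h1 x]

/-- Existence of a stationary distribution for a finite chain. -/
lemma finite_stationary {S : Type} [Fintype S] [DecidableEq S] [Nonempty S] (r : S → S → ℝ)
    (hr : ∀ s t, 0 ≤ r s t) :
    ∃ v : S → ℝ, (∀ s, 0 ≤ v s) ∧ ∑ s, v s = 1 ∧
      ∀ t, v t * ∑ s, r t s = ∑ s, v s * r s t := by
  let Q : Matrix S S ℝ := Matrix.of r - Matrix.diagonal (fun s => ∑ t, r s t)
  have hdet : Q.det = 0 := by
    rw [← Matrix.exists_mulVec_eq_zero_iff]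
    refine ⟨fun _ => 1, fun h => ?_, ?_⟩
    · obtain ⟨s⟩ := ‹Nonempty S›
      exact one_ne_zero (congrFun h s)
    · funext s
      simp [Q, Matrix.mulVec, dotProduct, Matrix.diagonal_apply]
  obtain ⟨v, hv0, hv⟩ := Matrix.exists_vecMul_eq_zero_iff.mpr hdet
  have hv' : ∀ t, v t * ∑ s, r t s = ∑ s, v s * r s t := by
    intro t
    have := congrFun hv t
    simp [Q, Matrix.vecMul, dotProduct, Matrix.diagonal_apply, mul_sub] at this
    linarith
  have hle : ∀ t, |v t| * ∑ s, r t s ≤ ∑ s, |v s| * r s t := by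
    intro t
    calc |v t| * ∑ s, r t s = |v t * ∑ s, r t s| := by
          rw [abs_mul, abs_of_nonneg (Finset.sum_nonneg fun s _ => hr t s)]
      _ = |∑ s, v s * r s t| := by rw [hv']
      _ ≤ ∑ s, |v s * r s t| := Finset.abs_sum_le_sum_abs _ _
      _ = ∑ s, |v s| * r s t := Finset.sum_congr rfl fun s _ => by
          rw [abs_mul, abs_of_nonneg (hr s t)]
  have hsum : ∑ t, |v t| * ∑ s, r t s = ∑ t, ∑ s, |v s| * r s t := by
    simp_rw [Finset.mul_sum]
    rw [Finset.sum_comm]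
  have heq := (Finset.sum_eq_sum_iff_of_le fun t _ => hle t).mp hsum
  have hpos : 0 < ∑ s, |v s| := by
    obtain ⟨s, hs⟩ := Function.ne_iff.mp hv0
    exact Finset.sum_pos' (fun s _ => abs_nonneg _) ⟨s, Finset.mem_univ _, abs_pos.mpr hs⟩
  refine ⟨fun s => |v s| / ∑ t, |v t|, fun s => by positivity, ?_, fun t => ?_⟩
  · rw [← Finset.sum_div, div_self hpos.ne']
  · have := heq t (Finset.mem_univ t)
    simp_rw [div_mul_eq_mul_div]
    rw [← Finset.sum_div, this]

/-- Truncated chain on levels `0..N`. -/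
lemma exists_trunc {Z : Type} [Fintype Z] [DecidableEq Z] [Nonempty Z] {μ : Z → Z → ℝ}
    (hμ : ∀ z y : Z, z ≠ y → 0 < μ z y) {κ : ℝ} (hκ : 0 < κ) {d : Z → ℕ → ℝ}
    (hd : ∀ x m, 0 ≤ d x m) (hd0 : ∀ x, d x 0 = 0) (N : ℕ) :
    ∃ π : Z → ℕ → ℝ, (∀ x m, 0 ≤ π x m) ∧ (∀ x m, N < m → π x m = 0) ∧
      (∑ x, ∑ m ∈ Finset.range (N + 1), π x m = 1) ∧
      ∀ x, ∀ m < N, BalAt μ κ d π x m := by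
  let r : Z → ℕ → Z → ℕ → ℝ := fun z i y j =>
    (if j = i then (if y ≠ z then μ z y else 0) else 0)
    + (if y = z then (if j = i + 1 then κ else 0) else 0)
    + (if y = z then (if i = j + 1 then d z i else 0) else 0)
  have hr : ∀ z i y j, 0 ≤ r z i y j := by
    intro z i y j
    refine add_nonneg (add_nonneg ?_ ?_) ?_
    · split_ifs with h1 h2
      · exact (hμ z y (Ne.symm h2)).le
      · exact le_rfl
      · exact le_rfl
    · split_ifs <;> first | exact hκ.le | exact le_rfl
    · split_ifs <;> first | exact hd _ _ | exact le_rfl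
  obtain ⟨v, hv0, hv1, hv⟩ := finite_stationary
    (S := Z × Fin (N + 1)) (fun s t => r s.1 s.2 t.1 t.2) (fun s t => hr _ _ _ _)
  let π : Z → ℕ → ℝ := fun x m => if h : m < N + 1 then v (x, ⟨m, h⟩) else 0
  have hπv : ∀ x (i : Fin (N + 1)), v (x, i) = π x i := by
    intro x i
    have := i.2
    simp only [π, dif_pos this]
  have hπN : ∀ x m, N < m → π x m = 0 := by
    intro x m h
    simp [π]
    omega
  refine ⟨π, ?_, hπN, ?_, ?_⟩
  · intro x m
    simp only [π]
    split_ifs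
    · exact hv0 _
    · exact le_rfl
  · rw [← hv1, Fintype.sum_prod_type]
    refine Finset.sum_congr rfl fun x _ => ?_
    simp_rw [hπv]
    rw [Fin.sum_univ_eq_sum_range (fun i => π x i)]
  · intro x m hm
    have h := hv (x, ⟨m, by omega⟩)
    simp only [Fintype.sum_prod_type, hπv] at h
    have hm1 : m < N + 1 := by omega
    have e1 : ∑ y, ∑ j : Fin (N + 1), r x m y j = qRate μ x + κ + d x m := by
      have : ∀ y, ∑ j : Fin (N + 1), r x m y j = ∑ j ∈ Finset.range (N + 1), r x m y j :=
        fun y => Fin.sum_univ_eq_sum_range (fun j => r x m y j) (N + 1)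
      simp_rw [this]
      simp only [r, Finset.sum_add_distrib]
      congr 1
      · congr 1
        · simp [qRate, Finset.sum_filter, hm1]
        · simp only [Finset.sum_ite_irrel, Finset.sum_const_zero]
          simp [hm]
      · simp only [Finset.sum_ite_irrel, Finset.sum_const_zero]
        cases m with
        | zero => simp [hd0]
        | succ k =>
          have : k < N + 1 := by omega
          simp [this]
    have e2 : ∑ y, ∑ j : Fin (N + 1), π y j * r y j x m
        = inflow μ (fun z => π z m) x + κ * (if 1 ≤ m then π x (m - 1) else 0)
      + d x (m + 1) * π x (m + 1) := by
      have : ∀ y, ∑ j : Fin (N + 1), π y j * r y j x m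
          = ∑ j ∈ Finset.range (N + 1), π y j * r y j x m :=
        fun y => Fin.sum_univ_eq_sum_range (fun j => π y j * r y j x m) (N + 1)
      simp_rw [this]
      simp only [r, mul_add, Finset.sum_add_distrib]
      congr 1
      · congr 1
        · simp [inflow, Finset.sum_filter, hm1, eq_comm]
        · simp only [mul_ite, mul_zero, Finset.sum_ite_irrel, Finset.sum_const_zero]
          cases m with
          | zero => simp
          | succ k =>
            have : k < N + 1 := by omega
            simp [this, mul_comm]
      · simp only [mul_ite, mul_zero, Finset.sum_ite_irrel, Finset.sum_const_zero]
        simp [hm, mul_comm]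
    unfold BalAt
    rw [← e2, ← e1]
    exact h

/-- Minimum principle. -/
lemma min_principle {Z : Type} [Fintype Z] [DecidableEq Z] {μ : Z → Z → ℝ}
    (hμ : ∀ z y : Z, z ≠ y → 0 < μ z y) {κ : ℝ} (hκ : 0 < κ) {d : Z → ℕ → ℝ}
    (hd : ∀ x m, 0 ≤ d x m) {ν : Z → ℝ} (hν : ∀ x, 0 < ν x)
    (hst : ∀ x, ν x * qRate μ x = inflow μ ν x) {D : Z → ℕ → ℝ}
    (hlim : ∀ x, Filter.Tendsto (D x) Filter.atTop (nhds 0)) (h0 : ∀ x, 0 ≤ D x 0)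
    (hsup : ∀ x m, inflow μ (fun z => D z (m + 1)) x + κ * D x m + d x (m + 1) * D x (m + 2)
      ≤ D x (m + 1) * (qRate μ x + κ + d x (m + 1))) :
    ∀ x m, 0 ≤ D x m := by
  by_contra hcon
  push Not at hcon
  obtain ⟨x₀, m₀, hneg⟩ := hcon
  have hc0 : D x₀ m₀ / ν x₀ < 0 := div_neg_of_neg_of_pos hneg (hν x₀)
  have hev : ∀ᶠ m in Filter.atTop, ∀ x, D x₀ m₀ / ν x₀ < D x m / ν x := by
    rw [Filter.eventually_all]
    intro x
    have h := (hlim x).div_const (ν x)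
    rw [zero_div] at h
    exact h.eventually (lt_mem_nhds hc0)
  obtain ⟨N, hN⟩ := Filter.eventually_atTop.mp hev
  have hm₀ : m₀ < N := by
    by_contra h
    exact lt_irrefl _ (hN m₀ (not_lt.mp h) x₀)
  obtain ⟨⟨x₁, m₁⟩, -, hmin⟩ := Finset.exists_min_image
    ((Finset.univ : Finset Z) ×ˢ Finset.range N) (fun p => D p.1 p.2 / ν p.1)
    ⟨(x₀, m₀), by simp [hm₀]⟩
  set c := D x₁ m₁ / ν x₁ with hc
  have hcle : c ≤ D x₀ m₀ / ν x₀ := hmin (x₀, m₀) (by simp [hm₀])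
  have hcneg : c < 0 := hcle.trans_lt hc0
  have hE : ∀ x m, 0 ≤ D x m - c * ν x := by
    intro x m
    have : c ≤ D x m / ν x := by
      by_cases h : m < N
      · exact hmin (x, m) (by simp [h])
      · exact hcle.trans (hN m (not_lt.mp h) x).le
    rw [le_div_iff₀ (hν x)] at this
    linarith
  have hne : ∀ m x, D x m - c * ν x ≠ 0 := by
    intro m
    induction m with
    | zero =>
      intro x
      have := h0 x
      have := mul_neg_of_neg_of_pos hcneg (hν x)
      linarith
    | succ k ih =>
      intro x hx
      have h1 := hsup x k
      have h2 := inflow_nonneg hμ (fun z => hE z (k + 1)) x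
      rw [inflow_sub μ (fun z => D z (k + 1)) (fun z => c * ν z), inflow_smul, ← hst] at h2
      have h3 : D x (k + 1) = c * ν x := by linarith
      have h4 := mul_nonneg (hd x (k + 1)) (hE x (k + 2))
      have h5 := mul_pos hκ (lt_of_le_of_ne (hE x k) (Ne.symm (ih x)))
      rw [h3] at h1
      nlinarith
  refine hne m₁ x₁ ?_
  rw [hc, div_mul_cancel₀ _ (hν x₁).ne', sub_self]

/-- Facts about the environment marginal. -/
lemma env_pos {Z : Type} [Fintype Z] [DecidableEq Z] {μ : Z → Z → ℝ}
    (hμ : ∀ z y : Z, z ≠ y → 0 < μ z y) {ν : Z → ℝ} (h0 : ∀ x, 0 ≤ ν x) (h1 : ∑ x, ν x = 1)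
    (hst : ∀ x, ν x * qRate μ x = inflow μ ν x) : ∀ x, 0 < ν x := by
  intro x
  refine lt_of_le_of_ne (h0 x) fun hx => ?_
  have h := hst x
  rw [← hx, zero_mul] at h
  have hz : ∀ z, ν z = 0 := by
    intro z
    by_cases hzx : z = x
    · rw [hzx, hx]
    · have := (Finset.sum_eq_zero_iff_of_nonneg (fun z hz =>
        mul_nonneg (h0 z) (hμ z x (by simpa using hz)).le)).mp h.symm z (by simpa using hzx)
      exact (mul_eq_zero.mp this).resolve_right (hμ z x hzx).ne'
  simp [hz] at h1

lemma env_unique {Z : Type} [Fintype Z] [DecidableEq Z] [Nonempty Z] {μ : Z → Z → ℝ}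
    (hμ : ∀ z y : Z, z ≠ y → 0 < μ z y) {ν ν' : Z → ℝ} (hpos : ∀ x, 0 < ν x)
    (h1 : ∑ x, ν x = 1) (hst : ∀ x, ν x * qRate μ x = inflow μ ν x)
    (h1' : ∑ x, ν' x = 1) (hst' : ∀ x, ν' x * qRate μ x = inflow μ ν' x) : ν' = ν := by
  obtain ⟨x₁, -, hmin⟩ := Finset.exists_min_image (Finset.univ : Finset Z)
    (fun x => ν' x / ν x) Finset.univ_nonempty
  set c := ν' x₁ / ν x₁ with hc
  have hE : ∀ x, 0 ≤ ν' x - c * ν x := by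
    intro x
    have : c ≤ ν' x / ν x := hmin x (Finset.mem_univ x)
    rw [le_div_iff₀ (hpos x)] at this
    linarith
  have hx₁ : ν' x₁ = c * ν x₁ := by rw [hc, div_mul_cancel₀ _ (hpos x₁).ne']
  have hin : inflow μ (fun z => ν' z - c * ν z) x₁ = 0 := by
    rw [inflow_sub μ ν' (fun z => c * ν z), inflow_smul, ← hst, ← hst', hx₁]
    ring
  have hz : ∀ z, ν' z - c * ν z = 0 := by
    intro z
    by_cases hzx : z = x₁
    · rw [hzx, hx₁, sub_self]
    · have := (Finset.sum_eq_zero_iff_of_nonneg (fun z hz =>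
        mul_nonneg (hE z) (hμ z x₁ (by simpa using hz)).le)).mp hin z (by simpa using hzx)
      exact (mul_eq_zero.mp this).resolve_right (hμ z x₁ hzx).ne'
  have hc1 : c = 1 := by
    have : ∑ x, (ν' x - c * ν x) = 0 := Finset.sum_eq_zero fun x _ => hz x
    rw [Finset.sum_sub_distrib, ← Finset.mul_sum, h1, h1'] at this
    linarith
  funext x
  have := hz x
  rw [hc1] at this
  linarith

/-- Probability solution with general death rates. -/
structure Sol {Z : Type} [Fintype Z] [DecidableEq Z] (μ : Z → Z → ℝ) (κ : ℝ)
    (d π : Z → ℕ → ℝ) : Prop where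
  nonneg : ∀ x m, 0 ≤ π x m
  summ : Summable (fun p : Z × ℕ => π p.1 p.2)
  one : ∑' p : Z × ℕ, π p.1 p.2 = 1
  bal : ∀ x m, BalAt μ κ d π x m

/-- Tail sums. -/
noncomputable def tailT {Z : Type} (π : Z → ℕ → ℝ) (x : Z) (m : ℕ) : ℝ := ∑' n, π x (n + m)

section
variable {Z : Type} [Fintype Z] [DecidableEq Z] {μ : Z → Z → ℝ} {κ : ℝ} {d π : Z → ℕ → ℝ}

lemma tail_step (h : Sol μ κ d π) (x : Z) (m : ℕ) :
    tailT π x m = π x m + tailT π x (m + 1) := by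
  have hs : Summable (fun n => π x (n + m)) :=
    (summable_nat_add_iff m).mpr ((tsum_levels h.summ).1 x)
  unfold tailT
  rw [hs.tsum_eq_zero_add]
  simp only [zero_add]
  congr 1
  refine tsum_congr fun n => ?_
  congr 1
  omega

lemma tail_lim (x : Z) : Filter.Tendsto (tailT π x) Filter.atTop (nhds 0) :=
  tendsto_sum_nat_add (π x)

lemma pi_lim (h : Sol μ κ d π) (x : Z) : Filter.Tendsto (π x) Filter.atTop (nhds 0) :=
  ((tsum_levels h.summ).1 x).tendsto_atTop_zero

lemma sol_cut (h : Sol μ κ d π) (hd0 : ∀ x, d x 0 = 0) (m : ℕ) :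
    κ * ∑ x, π x m = ∑ x, d x (m + 1) * π x (m + 1) :=
  cut_eq hd0 (m + 1) (fun x k _ => h.bal x k) m (Nat.lt_succ_self m)

lemma dpi_lim (h : Sol μ κ d π) (hd : ∀ x m, 0 ≤ d x m) (hd0 : ∀ x, d x 0 = 0) (x : Z) :
    Filter.Tendsto (fun m => d x m * π x m) Filter.atTop (nhds 0) := by
  rw [← Filter.tendsto_add_atTop_iff_nat 1]
  have hl : Filter.Tendsto (fun m => κ * ∑ x, π x m) Filter.atTop (nhds 0) := by
    have := (tendsto_finsetSum Finset.univ fun x _ => pi_lim h x).const_mul κ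
    simpa using this
  refine squeeze_zero (fun m => mul_nonneg (hd _ _) (h.nonneg _ _)) (fun m => ?_) hl
  rw [sol_cut h hd0]
  exact Finset.single_le_sum (f := fun x => d x (m + 1) * π x (m + 1))
    (fun z _ => mul_nonneg (hd _ _) (h.nonneg _ _)) (Finset.mem_univ x)

/-- Flux identity for the tails. -/
lemma tail_flux (h : Sol μ κ d π) (hd : ∀ x m, 0 ≤ d x m) (hd0 : ∀ x, d x 0 = 0) (x : Z) (m : ℕ) :
    tailT π x m * qRate μ x - inflow μ (fun z => tailT π z m) x
      = κ * (if 1 ≤ m then π x (m - 1) else 0) - d x m * π x m := by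
  let H : ℕ → ℝ := fun m => tailT π x m * qRate μ x - inflow μ (fun z => tailT π z m) x
      - (κ * (if 1 ≤ m then π x (m - 1) else 0) - d x m * π x m)
  have hstep : ∀ m, H (m + 1) = H m := by
    intro m
    have hb := h.bal x m
    unfold BalAt at hb
    have h1 := tail_step h x m
    have h2 : inflow μ (fun z => π z m) x
        = inflow μ (fun z => tailT π z m) x - inflow μ (fun z => tailT π z (m + 1)) x := by
      rw [← inflow_sub]
      congr 1
      funext z
      rw [tail_step h z m]; ring
    simp only [H, h1, Nat.le_add_left, if_true, Nat.add_sub_cancel]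
    rw [h2] at hb
    linarith
  have hconst : ∀ m, H m = H 0 := by
    intro m
    induction m with
    | zero => rfl
    | succ k ih => rw [hstep, ih]
  have hlim : Filter.Tendsto H Filter.atTop (nhds 0) := by
    have h1 : Filter.Tendsto (fun m => inflow μ (fun z => tailT π z m) x)
        Filter.atTop (nhds 0) := by
      have := tendsto_finsetSum (Finset.univ.filter (fun z => z ≠ x))
        fun z _ => (tail_lim (π := π) z).mul_const (μ z x)
      simpa [inflow] using this
    have h2 : Filter.Tendsto (fun m => κ * (if 1 ≤ m then π x (m - 1) else 0))
        Filter.atTop (nhds 0) := by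
      rw [← Filter.tendsto_add_atTop_iff_nat 1]
      simpa using (pi_lim h x).const_mul κ
    have := (((tail_lim (π := π) x).mul_const (qRate μ x)).sub h1).sub
      (h2.sub (dpi_lim h hd hd0 x))
    simpa [H] using this
  have h0 : H 0 = 0 := by
    have : H = fun _ => H 0 := funext hconst
    rw [this] at hlim
    exact tendsto_nhds_unique tendsto_const_nhds hlim
  have := (hconst m).trans h0
  simp only [H] at this
  linarith

lemma tail_env (h : Sol μ κ d π) (hd : ∀ x m, 0 ≤ d x m) (hd0 : ∀ x, d x 0 = 0) :
    (∀ x, 0 ≤ tailT π x 0) ∧ ∑ x, tailT π x 0 = 1 ∧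
      ∀ x, tailT π x 0 * qRate μ x = inflow μ (fun z => tailT π z 0) x := by
  refine ⟨fun x => tsum_nonneg fun n => h.nonneg _ _, ?_, fun x => ?_⟩
  · rw [← h.one, (tsum_levels h.summ).2.1]
    rfl
  · have := tail_flux h hd hd0 x 0
    simp [hd0] at this
    linarith

lemma tail_eq (h : Sol μ κ d π) (hd : ∀ x m, 0 ≤ d x m) (hd0 : ∀ x, d x 0 = 0) (x : Z) (m : ℕ) :
    inflow μ (fun z => tailT π z (m + 1)) x + κ * tailT π x m + d x (m + 1) * tailT π x (m + 2)
      = tailT π x (m + 1) * (qRate μ x + κ + d x (m + 1)) := by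
  have h1 := tail_flux h hd hd0 x (m + 1)
  have h2 := tail_step h x m
  have h3 := tail_step h x (m + 1)
  simp only [Nat.le_add_left, if_true, Nat.add_sub_cancel] at h1
  rw [h2]
  have h4 : π x (m + 1) = tailT π x (m + 1) - tailT π x (m + 2) := by linarith
  rw [h4] at h1
  linarith

lemma tail_compare [Nonempty Z] {κ' : ℝ} {π' : Z → ℕ → ℝ}
    (hμ : ∀ z y : Z, z ≠ y → 0 < μ z y) (hκ : 0 < κ) (hle : κ ≤ κ')
    (hd : ∀ x m, 0 ≤ d x m) (hd0 : ∀ x, d x 0 = 0)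
    (h : Sol μ κ d π) (h' : Sol μ κ' d π') :
    (∀ x m, tailT π x m ≤ tailT π' x m) ∧
      ((∀ x m, tailT π x (m + 1) = tailT π' x (m + 1)) → κ = κ') := by
  obtain ⟨e1, e2, e3⟩ := tail_env h hd hd0
  obtain ⟨e1', e2', e3'⟩ := tail_env h' hd hd0
  have hpos := env_pos hμ e1 e2 e3
  have hνeq := env_unique hμ hpos e2 e3 e2' e3'
  constructor
  · intro x m
    have := min_principle hμ (hκ.trans_le hle) hd hpos e3
      (D := fun x m => tailT π' x m - tailT π x m)
      (fun x => by simpa using (tail_lim (π := π') x).sub (tail_lim (π := π) x))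
      (fun x => by rw [congrFun hνeq x, sub_self])
      (fun x m => by
        rw [inflow_sub μ (fun z => tailT π' z (m + 1)) (fun z => tailT π z (m + 1))]
        have h1 := tail_eq h hd hd0 x m
        have h2 := tail_eq h' hd hd0 x m
        have h3 := tail_step h x m
        have h4 := mul_nonneg (sub_nonneg.mpr hle) (h.nonneg x m)
        have h5 : π x m = tailT π x m - tailT π x (m + 1) := by linarith
        rw [h5] at h4
        nlinarith) x m
    linarith
  · intro heq
    by_contra hne
    have hall : ∀ x m, tailT π x m = tailT π' x m := by
      intro x m
      cases m with
      | zero => exact (congrFun hνeq x).symm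
      | succ k => exact heq x k
    have hz : ∀ x m, π x m = 0 := by
      intro x m
      have h1 := tail_eq h hd hd0 x m
      have h2 := tail_eq h' hd hd0 x m
      simp only [← hall] at h2
      have h3 := tail_step h x m
      have h4 : (κ' - κ) * π x m = 0 := by
        have : π x m = tailT π x m - tailT π x (m + 1) := by linarith
        rw [this]
        linarith
      exact (mul_eq_zero.mp h4).resolve_left (sub_ne_zero.mpr (Ne.symm hne))
    have := h.one
    simp [hz] at this

/-- Shifted first moments. -/
noncomputable def momW {Z : Type} (π : Z → ℕ → ℝ) (x : Z) (m : ℕ) : ℝ :=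
  ∑' n : ℕ, (n : ℝ) * π x (n + m)

lemma mom_facts (h : Sol μ κ d π) (hs : Summable (fun p : Z × ℕ => (p.2 : ℝ) * π p.1 p.2))
    (x : Z) : (∀ m, momW π x m = momW π x (m + 1) + tailT π x (m + 1)) ∧
      Filter.Tendsto (momW π x) Filter.atTop (nhds 0) := by
  have h1 : Summable (fun n : ℕ => (n : ℝ) * π x n) :=
    (tsum_levels (f := fun x n => (n : ℝ) * π x n) hs).1 x
  have hle : ∀ m n : ℕ, (n : ℝ) * π x (n + m) ≤ ((n + m : ℕ) : ℝ) * π x (n + m) := fun m n => by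
    refine mul_le_mul_of_nonneg_right ?_ (h.nonneg _ _)
    exact_mod_cast Nat.le_add_right n m
  have hnn : ∀ m n : ℕ, 0 ≤ (n : ℝ) * π x (n + m) := fun m n =>
    mul_nonneg (Nat.cast_nonneg _) (h.nonneg _ _)
  have h2 : ∀ m : ℕ, Summable (fun n : ℕ => (n : ℝ) * π x (n + m)) := fun m =>
    Summable.of_nonneg_of_le (hnn m) (hle m) ((summable_nat_add_iff m).mpr h1)
  constructor
  · intro m
    have ht : Summable (fun n => π x (n + (m + 1))) :=
      (summable_nat_add_iff (m + 1)).mpr ((tsum_levels h.summ).1 x)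
    unfold momW tailT
    rw [(h2 m).tsum_eq_zero_add, ← (h2 (m + 1)).tsum_add ht]
    simp only [Nat.cast_zero, zero_mul, zero_add]
    refine tsum_congr fun n => ?_
    have : n + 1 + m = n + (m + 1) := by omega
    rw [this]
    push_cast
    ring
  · refine squeeze_zero (fun m => tsum_nonneg (hnn m)) (fun m => ?_)
      (tendsto_sum_nat_add (fun n : ℕ => (n : ℝ) * π x n))
    exact (h2 m).tsum_le_tsum (hle m) ((summable_nat_add_iff m).mpr h1)

lemma mean_compare [Nonempty Z] {κ' : ℝ} {π' : Z → ℕ → ℝ}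
    (hμ : ∀ z y : Z, z ≠ y → 0 < μ z y) (hκ : 0 < κ) (hle : κ ≤ κ')
    (hd : ∀ x m, 0 ≤ d x m) (hd0 : ∀ x, d x 0 = 0)
    (h : Sol μ κ d π) (h' : Sol μ κ' d π')
    (hs : Summable (fun p : Z × ℕ => (p.2 : ℝ) * π p.1 p.2))
    (hs' : Summable (fun p : Z × ℕ => (p.2 : ℝ) * π' p.1 p.2)) :
    (∑' p : Z × ℕ, (p.2 : ℝ) * π p.1 p.2 ≤ ∑' p : Z × ℕ, (p.2 : ℝ) * π' p.1 p.2) ∧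
    (∑' p : Z × ℕ, (p.2 : ℝ) * π p.1 p.2 = ∑' p : Z × ℕ, (p.2 : ℝ) * π' p.1 p.2 → κ = κ') := by
  obtain ⟨hT, hTeq⟩ := tail_compare hμ hκ hle hd hd0 h h'
  have hm : ∑' p : Z × ℕ, (p.2 : ℝ) * π p.1 p.2 = ∑ x, momW π x 0 :=
    (tsum_levels (f := fun x n => (n : ℝ) * π x n) hs).2.1
  have hm' : ∑' p : Z × ℕ, (p.2 : ℝ) * π' p.1 p.2 = ∑ x, momW π' x 0 :=
    (tsum_levels (f := fun x n => (n : ℝ) * π' x n) hs').2.1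
  have hanti : ∀ x, Antitone (fun m => momW π' x m - momW π x m) := by
    intro x
    refine antitone_nat_of_succ_le fun m => ?_
    have h1 := (mom_facts h hs x).1 m
    have h2 := (mom_facts h' hs' x).1 m
    have h3 := hT x (m + 1)
    linarith
  have hlim : ∀ x, Filter.Tendsto (fun m => momW π' x m - momW π x m) Filter.atTop (nhds 0) :=
    fun x => by simpa using (mom_facts h' hs' x).2.sub (mom_facts h hs x).2
  have hnn : ∀ x m, 0 ≤ momW π' x m - momW π x m := fun x m =>
    (hanti x).le_of_tendsto (hlim x) m
  rw [hm, hm']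
  refine ⟨Finset.sum_le_sum fun x _ => by linarith [hnn x 0], fun heq => hTeq ?_⟩
  have heq' := (Finset.sum_eq_sum_iff_of_le
    (fun x (_ : x ∈ (Finset.univ : Finset Z)) => sub_nonneg.mp (hnn x 0))).mp heq
  intro x m
  have h0 : momW π' x 0 - momW π x 0 = 0 := by
    rw [heq' x (Finset.mem_univ x), sub_self]
  have hz : ∀ m, momW π' x m - momW π x m = 0 := fun m =>
    le_antisymm (((hanti x) (Nat.zero_le m)).trans h0.le) (hnn x m)
  have h1 := (mom_facts h hs x).1 m
  have h2 := (mom_facts h' hs' x).1 m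
  linarith [hz m, hz (m + 1)]

end

section
variable {Z : Type} [Fintype Z] [DecidableEq Z] {μ : Z → Z → ℝ} {κ a lam : ℝ} {d π : Z → ℕ → ℝ}

/-- Dominating sequence. -/
noncomputable def cBd (κ a : ℝ) (m : ℕ) : ℝ := (κ / a) ^ m / (m.factorial : ℝ)

lemma cBd_nonneg (hκ : 0 < κ) (ha : 0 < a) (m : ℕ) : 0 ≤ cBd κ a m := by
  unfold cBd; positivity

lemma cBd_mono {κ' : ℝ} (hκ : 0 < κ) (ha : 0 < a) (h : κ ≤ κ') (m : ℕ) :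
    cBd κ a m ≤ cBd κ' a m := by
  unfold cBd; gcongr

lemma bound_of_cut (hκ : 0 < κ) (ha : 0 < a) (hda : ∀ x (m : ℕ), a * m ≤ d x m)
    (hnn : ∀ x m, 0 ≤ π x m) (hP0 : ∑ x, π x 0 ≤ 1)
    (hcut : ∀ m, ∑ x, d x (m + 1) * π x (m + 1) ≤ κ * ∑ x, π x m) (x : Z) (m : ℕ) :
    π x m ≤ cBd κ a m := by
  have h1 : ∑ x, π x m ≤ cBd κ a m := by
    refine level_bound (P := fun m => ∑ x, π x m) hκ ha hP0 (fun m => ?_) m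
    refine le_trans ?_ (hcut m)
    rw [Finset.mul_sum]
    refine Finset.sum_le_sum fun x _ => mul_le_mul_of_nonneg_right ?_ (hnn _ _)
    have := hda x (m + 1)
    push_cast at this
    exact this
  exact (Finset.single_le_sum (f := fun x => π x m) (fun z _ => hnn z m)
    (Finset.mem_univ x)).trans h1

lemma sol_bound (h : Sol μ κ d π) (hd0 : ∀ x, d x 0 = 0) (hκ : 0 < κ) (ha : 0 < a)
    (hda : ∀ x (m : ℕ), a * m ≤ d x m) (x : Z) (m : ℕ) : π x m ≤ cBd κ a m := by
  refine bound_of_cut hκ ha hda h.nonneg ?_ (fun m => (sol_cut h hd0 m).ge) x m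
  obtain ⟨-, -, h3, h4⟩ := tsum_levels h.summ
  rw [← h.one, h4]
  exact h3.le_tsum 0 fun n _ => Finset.sum_nonneg fun x _ => h.nonneg x n

lemma mean_summable (hκ : 0 < κ) (ha : 0 < a) (hnn : ∀ x m, 0 ≤ π x m)
    (hb : ∀ x m, π x m ≤ cBd κ a m) :
    Summable (fun p : Z × ℕ => (p.2 : ℝ) * π p.1 p.2) := by
  refine Summable.of_nonneg_of_le (fun p => mul_nonneg (Nat.cast_nonneg _) (hnn _ _))
    (fun p => mul_le_mul_of_nonneg_left (hb p.1 p.2) (Nat.cast_nonneg _))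
    (summable_prodc (f := fun m => (m : ℝ) * cBd κ a m) summable_mc
      fun n => mul_nonneg (Nat.cast_nonneg _) (cBd_nonneg hκ ha n))

lemma mean_bounds (h : Sol μ κ d π) (hd0 : ∀ x, d x 0 = 0)
    (hda : ∀ x (m : ℕ), a * m ≤ d x m) (hdl : ∀ x (m : ℕ), d x m ≤ lam * m)
    (hs : Summable (fun p : Z × ℕ => (p.2 : ℝ) * π p.1 p.2)) :
    a * (∑' p : Z × ℕ, (p.2 : ℝ) * π p.1 p.2) ≤ κ ∧
      κ ≤ lam * (∑' p : Z × ℕ, (p.2 : ℝ) * π p.1 p.2) := by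
  obtain ⟨-, -, h3, h4⟩ := tsum_levels h.summ
  obtain ⟨-, -, h3', h4'⟩ := tsum_levels (f := fun x n => (n : ℝ) * π x n) hs
  have hκ1 : κ = ∑' m, κ * ∑ x, π x m := by
    rw [tsum_mul_left, ← h4, h.one, mul_one]
  have hM : ∑' p : Z × ℕ, (p.2 : ℝ) * π p.1 p.2
      = ∑' m : ℕ, ∑ x, ((m + 1 : ℕ) : ℝ) * π x (m + 1) := by
    rw [h4', h3'.tsum_eq_zero_add]
    simp
  have hS : Summable (fun m : ℕ => ∑ x, ((m + 1 : ℕ) : ℝ) * π x (m + 1)) :=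
    (summable_nat_add_iff (f := fun m : ℕ => ∑ x, (m : ℝ) * π x m) 1).mpr h3'
  rw [hM, ← tsum_mul_left, ← tsum_mul_left]
  constructor
  · conv_rhs => rw [hκ1]
    refine (hS.mul_left a).tsum_le_tsum (fun m => ?_) (h3.mul_left κ)
    rw [sol_cut h hd0, Finset.mul_sum]
    refine Finset.sum_le_sum fun x _ => ?_
    rw [← mul_assoc]
    exact mul_le_mul_of_nonneg_right (hda x (m + 1)) (h.nonneg _ _)
  · conv_lhs => rw [hκ1]
    refine (h3.mul_left κ).tsum_le_tsum (fun m => ?_) (hS.mul_left lam)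
    rw [sol_cut h hd0, Finset.mul_sum]
    refine Finset.sum_le_sum fun x _ => ?_
    rw [← mul_assoc]
    exact mul_le_mul_of_nonneg_right (hdl x (m + 1)) (h.nonneg _ _)

/-- The compact set of dominated families. -/
def domC (Z : Type) (κ a : ℝ) : Set (Z → ℕ → ℝ) := Set.Icc 0 (fun _ m => cBd κ a m)

lemma mem_domC : π ∈ domC Z κ a ↔ (∀ x m, 0 ≤ π x m) ∧ ∀ x m, π x m ≤ cBd κ a m := Iff.rfl

lemma domC_summable (hκ : 0 < κ) (ha : 0 < a) (h : π ∈ domC Z κ a) :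
    Summable (fun p : Z × ℕ => π p.1 p.2) :=
  Summable.of_nonneg_of_le (fun p => (mem_domC.mp h).1 _ _) (fun p => (mem_domC.mp h).2 p.1 p.2)
    (summable_prodc (f := cBd κ a) summable_c (cBd_nonneg hκ ha))

lemma cont_mass (hκ : 0 < κ) (ha : 0 < a) :
    ContinuousOn (fun π : Z → ℕ → ℝ => ∑' p : Z × ℕ, π p.1 p.2) (domC Z κ a) := by
  refine continuousOn_tsum (u := fun p : Z × ℕ => cBd κ a p.2) (fun p => by fun_prop)
    (summable_prodc (f := cBd κ a) summable_c (cBd_nonneg hκ ha)) fun p π hπ => ?_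
  obtain ⟨h1, h2⟩ := mem_domC.mp hπ
  rw [Real.norm_of_nonneg (h1 _ _)]
  exact h2 _ _

lemma cont_mean (hκ : 0 < κ) (ha : 0 < a) :
    ContinuousOn (fun π : Z → ℕ → ℝ => ∑' p : Z × ℕ, (p.2 : ℝ) * π p.1 p.2) (domC Z κ a) := by
  refine continuousOn_tsum (u := fun p : Z × ℕ => (p.2 : ℝ) * cBd κ a p.2) (fun p => by fun_prop)
    (summable_prodc (f := fun m => (m : ℝ) * cBd κ a m) summable_mc
      fun n => mul_nonneg (Nat.cast_nonneg _) (cBd_nonneg hκ ha n)) fun p π hπ => ?_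
  obtain ⟨h1, h2⟩ := mem_domC.mp hπ
  rw [Real.norm_of_nonneg (mul_nonneg (Nat.cast_nonneg _) (h1 _ _))]
  exact mul_le_mul_of_nonneg_left (h2 _ _) (Nat.cast_nonneg _)

lemma cont_lhs (x : Z) (m : ℕ) : Continuous (fun p : ℝ × (Z → ℕ → ℝ) =>
    p.2 x m * (qRate μ x + p.1 + d x m)) := by fun_prop

lemma cont_rhs (x : Z) (m : ℕ) : Continuous (fun p : ℝ × (Z → ℕ → ℝ) =>
    inflow μ (fun z => p.2 z m) x + p.1 * (if 1 ≤ m then p.2 x (m - 1) else 0)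
      + d x (m + 1) * p.2 x (m + 1)) := by
  unfold inflow
  split_ifs <;> fun_prop

lemma exists_sol [Nonempty Z] (hμ : ∀ z y : Z, z ≠ y → 0 < μ z y) (hκ : 0 < κ) (ha : 0 < a)
    (hd0 : ∀ x, d x 0 = 0) (hda : ∀ x (m : ℕ), a * m ≤ d x m) :
    ∃ π, Sol μ κ d π := by
  have hd : ∀ x m, 0 ≤ d x m := fun x m => le_trans (by positivity) (hda x m)
  choose u hu0 huN hu1 hub using fun N => exists_trunc hμ hκ hd hd0 N
  have huC : ∀ N, u N ∈ domC Z κ a := by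
    intro N
    refine mem_domC.mpr ⟨hu0 N, bound_of_cut hκ ha hda (hu0 N) ?_ ?_⟩
    · rw [← hu1 N]
      refine Finset.sum_le_sum fun x _ => ?_
      exact Finset.single_le_sum (f := fun m => u N x m) (fun m _ => hu0 N x m) (by simp)
    · intro m
      by_cases hm : m < N
      · exact (cut_eq hd0 N (hub N) m hm).ge
      · have : ∑ x, d x (m + 1) * u N x (m + 1) = 0 :=
          Finset.sum_eq_zero fun x _ => by rw [huN N x (m + 1) (by omega), mul_zero]
        rw [this]
        exact mul_nonneg hκ.le (Finset.sum_nonneg fun x _ => hu0 N x m)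
  have hmass : ∀ N, ∑' p : Z × ℕ, u N p.1 p.2 = 1 := by
    intro N
    rw [(tsum_levels (domC_summable hκ ha (huC N))).2.1, ← hu1 N]
    refine Finset.sum_congr rfl fun x _ => ?_
    refine tsum_eq_sum fun m hm => huN N x m ?_
    simp at hm
    omega
  have hcomp : IsCompact (domC Z κ a) := isCompact_Icc
  obtain ⟨π, hπ, φ, hφ, hlim⟩ := hcomp.tendsto_subseq huC
  refine ⟨π, (mem_domC.mp hπ).1, domC_summable hκ ha hπ, ?_, fun x m => ?_⟩
  · have h1 := (cont_mass hκ ha) π hπ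
    have h2 : Filter.Tendsto (u ∘ φ) Filter.atTop (nhdsWithin π (domC Z κ a)) :=
      tendsto_nhdsWithin_iff.mpr ⟨hlim, Filter.Eventually.of_forall fun n => huC _⟩
    have h3 := h1.tendsto.comp h2
    refine tendsto_nhds_unique h3 ?_
    simp [Function.comp_def, hmass]
  · have h2 : Filter.Tendsto (fun n => (κ, u (φ n))) Filter.atTop (nhds (κ, π)) :=
      tendsto_const_nhds.prodMk_nhds hlim
    have h3 := ((cont_lhs (μ := μ) (d := d) x m).tendsto (κ, π)).comp h2
    have h4 := ((cont_rhs (μ := μ) (d := d) x m).tendsto (κ, π)).comp h2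
    refine tendsto_nhds_unique_of_eventuallyEq h3 h4 ?_
    filter_upwards [Filter.eventually_gt_atTop m] with n hn
    exact hub (φ n) x m (hn.trans_le hφ.le_apply)

lemma exists_kappa [Nonempty Z] (hμ : ∀ z y : Z, z ≠ y → 0 < μ z y) (ha : 0 < a)
    (hal : a ≤ lam) (hd0 : ∀ x, d x 0 = 0) (hda : ∀ x (m : ℕ), a * m ≤ d x m)
    (hdl : ∀ x (m : ℕ), d x m ≤ lam * m) {β : ℝ} (hβ : 0 < β) :
    ∃ κ, 0 < κ ∧ ∃ π, Sol μ κ d π ∧ ∑' p : Z × ℕ, (p.2 : ℝ) * π p.1 p.2 = β := by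
  have hd : ∀ x m, 0 ≤ d x m := fun x m => le_trans (by positivity) (hda x m)
  have hlo : 0 < a * β := mul_pos ha hβ
  have hlohi : a * β ≤ lam * β := mul_le_mul_of_nonneg_right hal hβ.le
  have hhi : 0 < lam * β := hlo.trans_le hlohi
  let M : (Z → ℕ → ℝ) → ℝ := fun π => ∑' p : Z × ℕ, (p.2 : ℝ) * π p.1 p.2
  let C : Set (Z → ℕ → ℝ) := domC Z (lam * β) a
  let I : Set ℝ := Set.Icc (a * β) (lam * β)
  have hmemC : ∀ κ ∈ I, ∀ π, Sol μ κ d π → π ∈ C := fun κ hκ π h =>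
    mem_domC.mpr ⟨h.nonneg, fun x m =>
      (sol_bound h hd0 (hlo.trans_le hκ.1) ha hda x m).trans
        (cBd_mono (hlo.trans_le hκ.1) ha hκ.2 m)⟩
  have hms : ∀ κ, 0 < κ → ∀ π, Sol μ κ d π →
      Summable (fun p : Z × ℕ => (p.2 : ℝ) * π p.1 p.2) := fun κ hκ π h =>
    mean_summable hκ ha h.nonneg (sol_bound h hd0 hκ ha hda)
  -- closedness of projections
  have hclosed : ∀ J : Set ℝ, IsClosed J → IsClosed {κ | κ ∈ I ∧ ∃ π, Sol μ κ d π ∧ M π ∈ J} := by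
    intro J hJ
    let K : Set (ℝ × (Z → ℕ → ℝ)) := (I ×ˢ (C ∩ {π | ∑' p : Z × ℕ, π p.1 p.2 = 1} ∩ (C ∩ M ⁻¹' J)))
      ∩ {p | ∀ x m, BalAt μ p.1 d p.2 x m}
    have hCcl : IsClosed C := isClosed_Icc
    have hCc : IsCompact C := isCompact_Icc
    have h1 : IsClosed (C ∩ {π | ∑' p : Z × ℕ, π p.1 p.2 = 1}) :=
      (cont_mass hhi ha).preimage_isClosed_of_isClosed hCcl (isClosed_singleton (x := (1 : ℝ)))
    have h2 : IsClosed (C ∩ M ⁻¹' J) :=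
      (cont_mean hhi ha).preimage_isClosed_of_isClosed hCcl hJ
    have h3 : IsClosed {p : ℝ × (Z → ℕ → ℝ) | ∀ x m, BalAt μ p.1 d p.2 x m} := by
      simp only [Set.setOf_forall]
      exact isClosed_iInter fun x => isClosed_iInter fun m =>
        isClosed_eq (cont_lhs x m) (cont_rhs x m)
    have h4 : IsCompact (C ∩ {π | ∑' p : Z × ℕ, π p.1 p.2 = 1} ∩ (C ∩ M ⁻¹' J)) :=
      hCc.of_isClosed_subset (h1.inter h2) fun p hp => hp.1.1
    have hK : IsCompact K := (isCompact_Icc.prod h4).inter_right h3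
    have : {κ | κ ∈ I ∧ ∃ π, Sol μ κ d π ∧ M π ∈ J} = Prod.fst '' K := by
      ext κ
      constructor
      · rintro ⟨hκ, π, h, hJ⟩
        have hC := hmemC κ hκ π h
        exact ⟨(κ, π), ⟨⟨hκ, ⟨hC, h.one⟩, hC, hJ⟩, h.bal⟩, rfl⟩
      · rintro ⟨⟨κ', π⟩, ⟨⟨hκ, ⟨hC, h1⟩, -, hJ⟩, hb⟩, rfl⟩
        exact ⟨hκ, π, ⟨(mem_domC.mp hC).1, domC_summable hhi ha hC, h1, hb⟩, hJ⟩
    rw [this]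
    exact (hK.image continuous_fst).isClosed
  have hconn : IsPreconnected I := isPreconnected_Icc
  have hex : ∀ κ ∈ I, ∃ π, Sol μ κ d π := fun κ hκ =>
    exists_sol hμ (hlo.trans_le hκ.1) ha hd0 hda
  obtain ⟨κ, hκ, ⟨-, π, hπ, hMle⟩, -, π', hπ', hMge⟩ :=
    isPreconnected_closed_iff.mp hconn _ _ (hclosed (Set.Iic β) isClosed_Iic)
      (hclosed (Set.Ici β) isClosed_Ici)
      (fun κ hκ => by
        obtain ⟨π, h⟩ := hex κ hκ
        rcases le_total (M π) β with h' | h'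
        · exact Or.inl ⟨hκ, π, h, h'⟩
        · exact Or.inr ⟨hκ, π, h, h'⟩)
      (by
        have hm : a * β ∈ I := ⟨le_rfl, hlohi⟩
        obtain ⟨π, h⟩ := hex _ hm
        refine ⟨_, hm, hm, π, h, ?_⟩
        have := (mean_bounds h hd0 hda hdl (hms _ hlo π h)).1
        exact le_of_mul_le_mul_left this ha)
      (by
        have hm : lam * β ∈ I := ⟨hlohi, le_rfl⟩
        obtain ⟨π, h⟩ := hex _ hm
        refine ⟨_, hm, hm, π, h, ?_⟩
        have := (mean_bounds h hd0 hda hdl (hms _ hhi π h)).2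
        exact le_of_mul_le_mul_left this (ha.trans_le hal))
  have hκ0 : 0 < κ := hlo.trans_le hκ.1
  refine ⟨κ, hκ0, π, hπ, le_antisymm hMle ?_⟩
  exact le_trans hMge (mean_compare hμ hκ0 le_rfl hd hd0 hπ' hπ (hms _ hκ0 _ hπ')
    (hms _ hκ0 _ hπ)).1

end

lemma sol_iff {Z : Type} [Fintype Z] [DecidableEq Z] {μ : Z → Z → ℝ} {lam γ κ : ℝ}
    {ξ π : Z → ℕ → ℝ} : IsProbSolution μ lam γ κ ξ π ↔
      Sol μ κ (fun x m => lam * m * (1 - γ * ξ x m)) π := by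
  have hb : Balance μ lam γ κ ξ π ↔
      ∀ x m, BalAt μ κ (fun x m => lam * m * (1 - γ * ξ x m)) π x m := by
    unfold Balance BalAt qRate inflow
    push_cast
    rfl
  constructor
  · rintro ⟨h1, h2, h3, h4⟩
    exact ⟨h1, h2, h3, hb.mp h4⟩
  · rintro ⟨h1, h2, h3, h4⟩
    exact ⟨h1, h2, h3, hb.mpr h4⟩

/-- **Existence and uniqueness of the equilibrium arrival rate** (Lemma from
Appendix D of the paper): for every Markovian strategy `ξ` there is exactly one
arrival rate `κ > 0` whose stationary distribution has mean `β`, and it lies in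
`[βλ(1-γ), βλ]`. -/
theorem kappa_exists_unique (Z : Type) [Fintype Z] [DecidableEq Z] [Nonempty Z]
    (μ : Z → Z → ℝ) (hμ : ∀ z y : Z, z ≠ y → 0 < μ z y)
    (lam γ β : ℝ) (hlam : 0 < lam) (hγ : γ ∈ Set.Ioo (0 : ℝ) 1) (hβ : 0 < β)
    (ξ : Z → ℕ → ℝ) (hξ : IsStrategy ξ) :
    (∃! κ : ℝ, 0 < κ ∧ ∃ π : Z → ℕ → ℝ, IsProbSolution μ lam γ κ ξ π ∧
        (∑' p : Z × ℕ, (p.2 : ℝ) * π p.1 p.2) = β) ∧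
    ∀ κ : ℝ, (0 < κ ∧ ∃ π : Z → ℕ → ℝ, IsProbSolution μ lam γ κ ξ π ∧
        (∑' p : Z × ℕ, (p.2 : ℝ) * π p.1 p.2) = β) →
      κ ∈ Set.Icc (β * lam * (1 - γ)) (β * lam) := by
  obtain ⟨hγ0, hγ1⟩ := hγ
  simp only [sol_iff]
  set d : Z → ℕ → ℝ := fun x m => lam * m * (1 - γ * ξ x m) with hdef
  set a : ℝ := lam * (1 - γ) with hadef
  have ha : 0 < a := mul_pos hlam (by linarith)
  have hal : a ≤ lam := by nlinarith
  have hd0 : ∀ x, d x 0 = 0 := fun x => by simp [d]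
  have hda : ∀ x (m : ℕ), a * m ≤ d x m := by
    intro x m
    have h1 : γ * ξ x m ≤ γ := by nlinarith [(hξ x m).2]
    have h2 : 0 ≤ lam * m := by positivity
    simp only [d, a]
    nlinarith
  have hdl : ∀ x (m : ℕ), d x m ≤ lam * m := by
    intro x m
    have h1 : 0 ≤ γ * ξ x m := mul_nonneg hγ0.le (hξ x m).1
    have h2 : 0 ≤ lam * m := by positivity
    simp only [d]
    nlinarith
  have hd : ∀ x m, 0 ≤ d x m := fun x m => le_trans (by positivity) (hda x m)
  have hms : ∀ κ, 0 < κ → ∀ π, Sol μ κ d π →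
      Summable (fun p : Z × ℕ => (p.2 : ℝ) * π p.1 p.2) := fun κ hκ π h =>
    mean_summable hκ ha h.nonneg (sol_bound h hd0 hκ ha hda)
  constructor
  · obtain ⟨κ, hκ, π, h, hM⟩ := exists_kappa hμ ha hal hd0 hda hdl hβ
    refine ⟨κ, ⟨hκ, π, h, hM⟩, ?_⟩
    rintro κ' ⟨hκ', π', h', hM'⟩
    rcases le_total κ κ' with hle | hle
    · exact ((mean_compare hμ hκ hle hd hd0 h h' (hms _ hκ _ h) (hms _ hκ' _ h')).2
        (hM.trans hM'.symm)).symm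
    · exact (mean_compare hμ hκ' hle hd hd0 h' h (hms _ hκ' _ h') (hms _ hκ _ h)).2
        (hM'.trans hM.symm)
  · rintro κ ⟨hκ, π, h, hM⟩
    have hb := mean_bounds h hd0 hda hdl (hms _ hκ _ h)
    rw [hM] at hb
    refine ⟨?_, ?_⟩
    · calc β * lam * (1 - γ) = a * β := by rw [hadef]; ring
        _ ≤ κ := hb.1
    · linarith [hb.2]
end

section
/- Let κ(ξ) denote, for each Markovian strategy ξ, the unique arrival rate κ ∈ [β·λ·(1−γ), β·λ] for which the unique probability solution π of the balance equations for (ξ,κ) satisfies ∑_{(z,n)∈S} n·π(z,n) = β. Then the map ξ ↦ κ(ξ) is continuous with respect to the sup-norm on strategies: for every ε > 0 there is δ > 0 such that sup_{(z,n)∈S} |ξ₁(z,n) − ξ₂(z,n)| < δ implies |κ(ξ₁) − κ(ξ₂)| < ε. -/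
open scoped BigOperators

variable {Z : Type}

open Filter Topology

section helpers
variable [Fintype Z] [DecidableEq Z]

lemma flow_sum (μ : Z → Z → ℝ) (f : Z → ℝ) :
    ∑ x, f x * (∑ y ∈ Finset.univ.filter (fun y => y ≠ x), μ x y)
      = ∑ x, ∑ z ∈ Finset.univ.filter (fun z => z ≠ x), f z * μ z x := by
  simp only [Finset.sum_filter, Finset.mul_sum]
  rw [Finset.sum_comm]
  refine Finset.sum_congr rfl fun x _ => Finset.sum_congr rfl fun y _ => ?_
  by_cases h : x = y
  · simp [h]
  · simp [h, Ne.symm h]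

lemma cut_eq_s16 {μ : Z → Z → ℝ} {lam γ κ : ℝ} {ξ π : Z → ℕ → ℝ}
    (h : Balance μ lam γ κ ξ π) (m : ℕ) :
    κ * ∑ x, π x m = ∑ x, lam * (m + 1) * (1 - γ * ξ x (m + 1)) * π x (m + 1) := by
  have key : ∀ m : ℕ, (∑ x, lam * m * (1 - γ * ξ x m) * π x m) + κ * ∑ x, π x m
      = (∑ x, κ * (if 1 ≤ m then π x (m - 1) else 0))
        + ∑ x, lam * (m + 1) * (1 - γ * ξ x (m + 1)) * π x (m + 1) := by
    intro m
    have h1 := Finset.sum_congr (rfl : (Finset.univ : Finset Z) = Finset.univ)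
      (fun x _ => h x m)
    simp only [mul_add, Finset.sum_add_distrib] at h1
    rw [flow_sum] at h1
    have h2 : ∑ x, lam * m * (1 - γ * ξ x m) * π x m
        = ∑ x, π x m * (lam * m * (1 - γ * ξ x m)) :=
      Finset.sum_congr rfl fun x _ => by ring
    have h3 : κ * ∑ x, π x m = ∑ x, π x m * κ := by
      rw [Finset.mul_sum]; exact Finset.sum_congr rfl fun x _ => by ring
    have h4 : ∑ x, lam * ((m : ℝ) + 1) * (1 - γ * ξ x (m + 1)) * π x (m + 1)
        = ∑ x, (lam * m + lam * 1) * (1 - γ * ξ x (m + 1)) * π x (m + 1) :=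
      Finset.sum_congr rfl fun x _ => by ring
    rw [h2, h3, h4]
    linarith
  induction m with
  | zero => have := key 0; simpa using this
  | succ m ih =>
    have := key (m + 1)
    simp only [Nat.le_add_left, if_true, Nat.add_sub_cancel, ← Finset.mul_sum] at this
    rw [ih] at this
    push_cast at this ⊢
    linarith

lemma pois_bound {μ : Z → Z → ℝ} {lam γ κ c : ℝ} {ξ π : Z → ℕ → ℝ}
    (hlam : 0 < lam) (hγ : γ ∈ Set.Ioo (0 : ℝ) 1) (hξ : IsStrategy ξ)
    (hc : 0 ≤ c) (hκ : κ ≤ c * (lam * (1 - γ)))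
    (h : IsProbSolution μ lam γ κ ξ π) (x : Z) (n : ℕ) :
    π x n ≤ c ^ n / n.factorial := by
  obtain ⟨hpos, hs, hsum, hb⟩ := h
  have hg : 0 < 1 - γ := by linarith [hγ.2]
  have h0 : ∑ x, π x 0 ≤ 1 := by
    have := hs.sum_le_tsum ((Finset.univ : Finset Z).map ⟨fun z => (z, 0), fun a b h => by simpa using h⟩)
      (fun p _ => hpos p.1 p.2)
    rw [hsum, Finset.sum_map] at this
    exact this
  have hp : ∀ n, ∑ x, π x n ≤ c ^ n / n.factorial := by
    intro n
    induction n with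
    | zero => simpa using h0
    | succ m ih =>
      have h1 := cut_eq_s16 hb m
      have h2 : lam * (m + 1) * (1 - γ) * ∑ x, π x (m + 1)
          ≤ ∑ x, lam * (m + 1) * (1 - γ * ξ x (m + 1)) * π x (m + 1) := by
        rw [Finset.mul_sum]
        refine Finset.sum_le_sum fun x _ => ?_
        refine mul_le_mul_of_nonneg_right ?_ (hpos _ _)
        refine mul_le_mul_of_nonneg_left ?_ (by positivity)
        nlinarith [(hξ x (m + 1)).2, hγ.1]
      have hpm : 0 ≤ ∑ x, π x m := Finset.sum_nonneg fun x _ => hpos _ _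
      have h3 : κ * ∑ x, π x m ≤ c * (lam * (1 - γ)) * (c ^ m / m.factorial) :=
        (mul_le_mul_of_nonneg_right hκ hpm).trans
          (mul_le_mul_of_nonneg_left ih (by positivity))
      have h4 : (lam * (1 - γ)) * ((m + 1) * ∑ x, π x (m + 1))
          ≤ (lam * (1 - γ)) * (c * (c ^ m / m.factorial)) := by linarith
      have h5 := le_of_mul_le_mul_left h4 (by positivity)
      rw [Nat.factorial_succ]
      push_cast
      rw [le_div_iff₀ (by positivity)]
      have h6 : c * (c ^ m / m.factorial) * m.factorial = c ^ (m + 1) := by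
        field_simp
        ring
      have h7 : (0 : ℝ) < m.factorial := by positivity
      nlinarith [mul_le_mul_of_nonneg_right h5 h7.le]
  exact (Finset.single_le_sum (f := fun x => π x n) (fun x _ => hpos x n) (Finset.mem_univ x)).trans (hp n)

lemma summable_pois (c : ℝ) (hc : 0 ≤ c) :
    Summable (fun n : ℕ => (n : ℝ) * (c ^ n / n.factorial)) := by
  refine Summable.of_nonneg_of_le (fun n => by positivity) (fun n => ?_)
    (Real.summable_pow_div_factorial (2 * c))
  rw [mul_pow, mul_div_assoc]
  refine mul_le_mul_of_nonneg_right ?_ (by positivity)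
  exact_mod_cast (Nat.lt_two_pow_self (n := n)).le

lemma summable_pois_prod (c : ℝ) (hc : 0 ≤ c) :
    Summable (fun p : Z × ℕ => (p.2 : ℝ) * (c ^ p.2 / p.2.factorial)) ∧
    Summable (fun p : Z × ℕ => (c ^ p.2 / p.2.factorial)) := by
  have h1 : Summable (fun _ : Z => (1 : ℝ)) := Summable.of_finite
  constructor
  · simpa using h1.mul_of_nonneg (summable_pois c hc) (fun _ => zero_le_one)
      (fun n => by positivity)
  · simpa using h1.mul_of_nonneg (Real.summable_pow_div_factorial c) (fun _ => zero_le_one)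
      (fun n => by positivity)

/-- Tail of a sequence. -/
noncomputable def tl (f : ℕ → ℝ) (n : ℕ) : ℝ := ∑' k, f (k + n)

lemma tl_succ {f : ℕ → ℝ} (hf : Summable f) (n : ℕ) : tl f n = f n + tl f (n + 1) := by
  unfold tl
  have h := ((summable_nat_add_iff n).2 hf).tsum_eq_zero_add
  rw [h]
  simp only [zero_add]
  congr 1
  refine tsum_congr fun k => ?_
  congr 1
  ring

lemma tl_tendsto (f : ℕ → ℝ) : Tendsto (tl f) atTop (𝓝 0) := tendsto_sum_nat_add f

lemma tail_eq_s16 {μ : Z → Z → ℝ} {lam γ κ : ℝ} {ξ π : Z → ℕ → ℝ}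
    (hlam : 0 < lam) (hγ : γ ∈ Set.Ioo (0 : ℝ) 1) (hξ : IsStrategy ξ)
    (hpos : ∀ z n, 0 ≤ π z n)
    (hs : ∀ x, Summable (π x)) (hs1 : ∀ x, Summable (fun n : ℕ => (n : ℝ) * π x n))
    (hb : Balance μ lam γ κ ξ π) (x : Z) (n : ℕ) :
    (∑ z ∈ Finset.univ.filter (fun z => z ≠ x), tl (π z) n * μ z x)
      - tl (π x) n * (∑ y ∈ Finset.univ.filter (fun y => y ≠ x), μ x y)
      + κ * (if 1 ≤ n then π x (n - 1) else 0) - lam * n * (1 - γ * ξ x n) * π x n = 0 := by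
  set E : ℕ → ℝ := fun n => (∑ z ∈ Finset.univ.filter (fun z => z ≠ x), tl (π z) n * μ z x)
      - tl (π x) n * (∑ y ∈ Finset.univ.filter (fun y => y ≠ x), μ x y)
      + κ * (if 1 ≤ n then π x (n - 1) else 0) - lam * n * (1 - γ * ξ x n) * π x n with hE
  have hstep : ∀ n, E (n + 1) = E n := by
    intro n
    have h1 := hb x n
    have h2 : ∑ z ∈ Finset.univ.filter (fun z => z ≠ x), tl (π z) n * μ z x
        = (∑ z ∈ Finset.univ.filter (fun z => z ≠ x), π z n * μ z x)
        + ∑ z ∈ Finset.univ.filter (fun z => z ≠ x), tl (π z) (n + 1) * μ z x := by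
      rw [← Finset.sum_add_distrib]
      exact Finset.sum_congr rfl fun z _ => by rw [tl_succ (hs z) n]; ring
    have h3 := tl_succ (hs x) n
    simp only [hE]
    rw [h2, h3]
    simp only [Nat.le_add_left, if_true, Nat.add_sub_cancel]
    push_cast
    linarith
  have hconst : ∀ n, E n = E 0 := by
    intro n
    induction n with
    | zero => rfl
    | succ n ih => rw [hstep, ih]
  have hlim : Tendsto (fun n => E (n + 1)) atTop (𝓝 0) := by
    have t1 : Tendsto (fun n => ∑ z ∈ Finset.univ.filter (fun z => z ≠ x), tl (π z) (n + 1) * μ z x)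
        atTop (𝓝 0) := by
      have : Tendsto (fun n => ∑ z ∈ Finset.univ.filter (fun z => z ≠ x), tl (π z) (n + 1) * μ z x)
        atTop (𝓝 (∑ z ∈ Finset.univ.filter (fun z => z ≠ x), 0 * μ z x)) :=
        tendsto_finsetSum _ fun z _ =>
          ((tl_tendsto (π z)).comp (tendsto_add_atTop_nat 1)).mul_const _
      simpa using this
    have t2 : Tendsto (fun n => tl (π x) (n + 1) * (∑ y ∈ Finset.univ.filter (fun y => y ≠ x), μ x y))
        atTop (𝓝 (0 * _)) :=
      ((tl_tendsto (π x)).comp (tendsto_add_atTop_nat 1)).mul_const _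
    have t3 : Tendsto (fun n => κ * π x n) atTop (𝓝 (κ * 0)) :=
      (hs x).tendsto_atTop_zero.const_mul _
    have t4' : Tendsto (fun n : ℕ => lam * ((n : ℝ) * π x n)) atTop (𝓝 (lam * 0)) :=
      (hs1 x).tendsto_atTop_zero.const_mul _
    have t4 : Tendsto (fun n : ℕ => lam * (n : ℝ) * (1 - γ * ξ x n) * π x n) atTop (𝓝 0) := by
      rw [mul_zero] at t4'
      refine squeeze_zero (fun n => ?_) (fun n => ?_) t4'
      · have : 0 ≤ 1 - γ * ξ x n := by nlinarith [(hξ x n).1, (hξ x n).2, hγ.1, hγ.2]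
        have := hpos x n
        positivity
      · have h1 : 1 - γ * ξ x n ≤ 1 := by nlinarith [(hξ x n).1, (hξ x n).2, hγ.1, hγ.2]
        have := mul_nonneg (mul_nonneg hlam.le (Nat.cast_nonneg (α := ℝ) n)) (hpos x n)
        nlinarith
    have t5 := ((t1.sub t2).add t3).sub (t4.comp (tendsto_add_atTop_nat 1))
    simp only [zero_mul, mul_zero, sub_zero, add_zero] at t5
    refine t5.congr fun n => ?_
    simp [hE]
  have : E 0 = 0 := by
    refine tendsto_nhds_unique ?_ hlim
    exact tendsto_const_nhds.congr fun n => (hconst _).symm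
  exact (hconst n).trans this

lemma rho_pos {μ : Z → Z → ℝ} (hμ : ∀ z y : Z, z ≠ y → 0 < μ z y) {ρ : Z → ℝ}
    (h0 : ∀ x, 0 ≤ ρ x) (h1 : ∑ x, ρ x = 1)
    (hst : ∀ x, ∑ z ∈ Finset.univ.filter (fun z => z ≠ x), ρ z * μ z x
      = ρ x * ∑ y ∈ Finset.univ.filter (fun y => y ≠ x), μ x y) (x : Z) : 0 < ρ x := by
  rcases (h0 x).lt_or_eq with h | h
  · exact h
  exfalso
  have h2 := hst x
  rw [← h, zero_mul, Finset.sum_eq_zero_iff_of_nonneg] at h2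
  · have : ∀ z, ρ z = 0 := by
      intro z
      by_cases hz : z = x
      · rw [hz, h]
      · have := h2 z (by simp [hz])
        exact (mul_eq_zero.1 this).resolve_right (hμ z x hz).ne'
    simp [this] at h1
  · intro z hz
    exact mul_nonneg (h0 z) (hμ z x (by simpa using hz)).le

lemma rho_unique [Nonempty Z] {μ : Z → Z → ℝ} (hμ : ∀ z y : Z, z ≠ y → 0 < μ z y) {ρ ρ' : Z → ℝ}
    (hp' : ∀ x, 0 < ρ' x) (h1 : ∑ x, ρ x = 1) (h1' : ∑ x, ρ' x = 1)
    (hst : ∀ x, ∑ z ∈ Finset.univ.filter (fun z => z ≠ x), ρ z * μ z x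
      = ρ x * ∑ y ∈ Finset.univ.filter (fun y => y ≠ x), μ x y)
    (hst' : ∀ x, ∑ z ∈ Finset.univ.filter (fun z => z ≠ x), ρ' z * μ z x
      = ρ' x * ∑ y ∈ Finset.univ.filter (fun y => y ≠ x), μ x y) (z : Z) : ρ z = ρ' z := by
  obtain ⟨x, hx⟩ := Finite.exists_min (fun x => ρ x / ρ' x)
  set c := ρ x / ρ' x with hc
  have hge : ∀ z, 0 ≤ ρ z - c * ρ' z := by
    intro z
    have := (le_div_iff₀ (hp' z)).1 (hx z)
    linarith
  have hxe : ρ x = c * ρ' x := by rw [hc, div_mul_cancel₀ _ (hp' x).ne']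
  have h2 : ∑ z ∈ Finset.univ.filter (fun z => z ≠ x), (ρ z - c * ρ' z) * μ z x = 0 := by
    simp only [sub_mul, Finset.sum_sub_distrib, mul_assoc, ← Finset.mul_sum]
    rw [hst, hst', hxe]
    ring
  rw [Finset.sum_eq_zero_iff_of_nonneg] at h2
  · have h3 : ∀ z, ρ z = c * ρ' z := by
      intro z
      by_cases hz : z = x
      · rw [hz, hxe]
      · have := h2 z (by simp [hz])
        have := (mul_eq_zero.1 this).resolve_right (hμ z x hz).ne'
        linarith
    have h4 : c = 1 := by
      have : ∑ z, ρ z = c * ∑ z, ρ' z := by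
        rw [Finset.mul_sum]; exact Finset.sum_congr rfl fun z _ => h3 z
      rw [h1, h1'] at this
      linarith
    rw [h3, h4, one_mul]
  · intro z hz
    exact mul_nonneg (hge z) (hμ z x (by simpa using hz)).le

lemma min_principle_s16 {μ : Z → Z → ℝ} (hμ : ∀ z y : Z, z ≠ y → 0 < μ z y) {ρ : Z → ℝ}
    (hp : ∀ x, 0 < ρ x)
    (hst : ∀ x, ∑ z ∈ Finset.univ.filter (fun z => z ≠ x), ρ z * μ z x
      = ρ x * ∑ y ∈ Finset.univ.filter (fun y => y ≠ x), μ x y)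
    {κ : ℝ} (hκ : 0 < κ) {d w : Z → ℕ → ℝ} (hd : ∀ x n, 0 ≤ d x n)
    (hw0 : ∀ x, w x 0 = 0) (hwl : ∀ x, Tendsto (w x) atTop (𝓝 0))
    (hsup : ∀ x n, (∑ z ∈ Finset.univ.filter (fun z => z ≠ x), w z (n + 1) * μ z x)
      + κ * w x n + d x n * w x (n + 2)
      ≤ w x (n + 1) * ((∑ y ∈ Finset.univ.filter (fun y => y ≠ x), μ x y) + κ + d x n))
    (x : Z) (n : ℕ) : 0 ≤ w x n := by
  by_contra hneg
  push Not at hneg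
  set m0 := w x n / ρ x with hm0
  have hm0neg : m0 < 0 := div_neg_of_neg_of_pos hneg (hp x)
  have hev : ∀ᶠ k in atTop, ∀ z, m0 < w z k / ρ z := by
    rw [eventually_all]
    intro z
    have : Tendsto (fun k => w z k / ρ z) atTop (𝓝 (0 / ρ z)) := (hwl z).div_const _
    rw [zero_div] at this
    exact this.eventually (lt_mem_nhds hm0neg)
  obtain ⟨N, hN⟩ := eventually_atTop.1 hev
  have hnN : n < N := by
    by_contra h
    exact lt_irrefl _ (hN n (not_lt.1 h) x)
  obtain ⟨⟨a, k⟩, hak, hmin⟩ := Finset.exists_min_image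
    ((Finset.univ : Finset Z) ×ˢ Finset.range N) (fun p => w p.1 p.2 / ρ p.1)
    ⟨(x, n), by simp [hnN]⟩
  set m := w a k / ρ a with hm
  have hmm0 : m ≤ m0 := hmin (x, n) (by simp [hnN])
  have hge : ∀ z j, m * ρ z ≤ w z j := by
    intro z j
    rw [← le_div_iff₀ (hp z)]
    by_cases hj : j < N
    · exact hmin (z, j) (by simp [hj])
    · exact hmm0.trans (hN j (not_lt.1 hj) z).le
  have hdown : ∀ j, w a j ≤ m * ρ a → w a 0 ≤ m * ρ a := by
    intro j
    induction j with
    | zero => exact id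
    | succ j ih =>
      intro hj
      apply ih
      have hje : w a (j + 1) = m * ρ a := le_antisymm hj (hge _ _)
      have h1 := hsup a j
      have h2 : m * ∑ z ∈ Finset.univ.filter (fun z => z ≠ a), ρ z * μ z a
          ≤ ∑ z ∈ Finset.univ.filter (fun z => z ≠ a), w z (j + 1) * μ z a := by
        rw [Finset.mul_sum]
        refine Finset.sum_le_sum fun z hz => ?_
        rw [← mul_assoc]
        exact mul_le_mul_of_nonneg_right (hge _ _) (hμ z a (by simpa using hz)).le
      rw [hst] at h2
      have h3 := mul_le_mul_of_nonneg_left (hge a (j + 2)) (hd a j)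
      rw [hje] at h1
      have h4 : κ * w a j ≤ κ * (m * ρ a) := by linarith
      exact le_of_mul_le_mul_left h4 hκ
  have h5 := hdown k (by rw [hm, div_mul_cancel₀ _ (hp a).ne'])
  rw [hw0] at h5
  have : m * ρ a < 0 := mul_neg_of_neg_of_pos (hmm0.trans_lt hm0neg) (hp a)
  linarith

lemma abel {f : ℕ → ℝ} (hf : Summable f) (M : ℕ) :
    ∑ n ∈ Finset.range M, (tl f (n + 1) - n * f n) = M * tl f M := by
  induction M with
  | zero => simp
  | succ M ih =>
    rw [Finset.sum_range_succ, ih, tl_succ hf M]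
    push_cast
    ring

lemma tl_nonneg {f : ℕ → ℝ} (h : ∀ n, 0 ≤ f n) (n : ℕ) : 0 ≤ tl f n :=
  tsum_nonneg fun _ => h _

lemma mul_tl_tendsto {f : ℕ → ℝ} (h0 : ∀ n, 0 ≤ f n) (hf : Summable f)
    (hf1 : Summable (fun n : ℕ => (n : ℝ) * f n)) :
    Tendsto (fun M : ℕ => (M : ℝ) * tl f M) atTop (𝓝 0) := by
  refine squeeze_zero (fun n => mul_nonneg (Nat.cast_nonneg _) (tl_nonneg h0 n)) (fun n => ?_)
    (tl_tendsto (fun n : ℕ => (n : ℝ) * f n))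
  unfold tl
  rw [← tsum_mul_left]
  refine Summable.tsum_le_tsum (fun k => ?_) (((summable_nat_add_iff n).2 hf).mul_left _)
    ((summable_nat_add_iff n).2 hf1)
  refine mul_le_mul_of_nonneg_right ?_ (h0 _)
  push_cast
  linarith [Nat.cast_nonneg (α := ℝ) k]

/-- The sum of tails is the mean. -/
lemma tail_mean {f : ℕ → ℝ} (h0 : ∀ n, 0 ≤ f n) (hf : Summable f)
    (hf1 : Summable (fun n : ℕ => (n : ℝ) * f n)) :
    HasSum (fun n => tl f (n + 1)) (∑' n : ℕ, (n : ℝ) * f n) := by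
  rw [hasSum_iff_tendsto_nat_of_nonneg (fun n => tl_nonneg h0 _)]
  have := (mul_tl_tendsto h0 hf hf1).add hf1.hasSum.tendsto_sum_nat
  rw [zero_add] at this
  refine this.congr fun M => ?_
  rw [← abel hf M, Finset.sum_sub_distrib]
  ring

lemma unique_aux [Nonempty Z] {μ : Z → Z → ℝ} (hμ : ∀ z y : Z, z ≠ y → 0 < μ z y)
    {lam γ c κ₁ κ₂ β : ℝ} (hlam : 0 < lam) (hγ : γ ∈ Set.Ioo (0 : ℝ) 1) {ξ π₁ π₂ : Z → ℕ → ℝ}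
    (hξ : IsStrategy ξ) (hc : 0 ≤ c) (hκ₁ : κ₁ ≤ c * (lam * (1 - γ)))
    (hκ₂ : κ₂ ≤ c * (lam * (1 - γ))) (hk : 0 < κ₂) (hlt : κ₁ < κ₂)
    (h₁ : IsProbSolution μ lam γ κ₁ ξ π₁) (h₂ : IsProbSolution μ lam γ κ₂ ξ π₂)
    (hm₁ : (∑' p : Z × ℕ, (p.2 : ℝ) * π₁ p.1 p.2) = β)
    (hm₂ : (∑' p : Z × ℕ, (p.2 : ℝ) * π₂ p.1 p.2) = β) : False := by
  have hS : ∀ {κ : ℝ} {π : Z → ℕ → ℝ}, κ ≤ c * (lam * (1 - γ)) → IsProbSolution μ lam γ κ ξ π →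
      (∑' p : Z × ℕ, (p.2 : ℝ) * π p.1 p.2) = β →
      (∀ x, Summable (π x)) ∧ (∀ x, Summable (fun n : ℕ => (n : ℝ) * π x n)) ∧
      (∑ x, tl (π x) 0 = 1) ∧ HasSum (fun n => ∑ x, tl (π x) (n + 1)) β := by
    intro κ π hκ h hm
    have hb := pois_bound hlam hγ hξ hc hκ h
    have hs : ∀ x, Summable (π x) := fun x =>
      Summable.of_nonneg_of_le (fun n => h.1 x n) (hb x) (Real.summable_pow_div_factorial c)
    have hs1 : ∀ x, Summable (fun n : ℕ => (n : ℝ) * π x n) := fun x =>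
      Summable.of_nonneg_of_le (fun n => mul_nonneg (Nat.cast_nonneg _) (h.1 x n))
        (fun n => mul_le_mul_of_nonneg_left (hb x n) (Nat.cast_nonneg _)) (summable_pois c hc)
    have hsp : Summable (fun p : Z × ℕ => (p.2 : ℝ) * π p.1 p.2) :=
      Summable.of_nonneg_of_le (fun p => mul_nonneg (Nat.cast_nonneg _) (h.1 p.1 p.2))
        (fun p => mul_le_mul_of_nonneg_left (hb p.1 p.2) (Nat.cast_nonneg _))
        (summable_pois_prod c hc).1
    refine ⟨hs, hs1, ?_, ?_⟩
    · rw [← h.2.2.1, h.2.1.tsum_prod, tsum_fintype]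
      rfl
    · rw [← hm, hsp.tsum_prod, tsum_fintype]
      exact hasSum_sum fun x _ => tail_mean (h.1 x) (hs x) (hs1 x)
  obtain ⟨s₁, t₁, r₁, e₁⟩ := hS hκ₁ h₁ hm₁
  obtain ⟨s₂, t₂, r₂, e₂⟩ := hS hκ₂ h₂ hm₂
  have T₁ := tail_eq_s16 hlam hγ hξ h₁.1 s₁ t₁ h₁.2.2.2
  have T₂ := tail_eq_s16 hlam hγ hξ h₂.1 s₂ t₂ h₂.2.2.2
  have st₁ : ∀ x, ∑ z ∈ Finset.univ.filter (fun z => z ≠ x), tl (π₁ z) 0 * μ z x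
      = tl (π₁ x) 0 * ∑ y ∈ Finset.univ.filter (fun y => y ≠ x), μ x y := by
    intro x
    have := T₁ x 0
    simp only [Nat.cast_zero, mul_zero, zero_mul, nonpos_iff_eq_zero, one_ne_zero, if_false] at this
    linarith
  have st₂ : ∀ x, ∑ z ∈ Finset.univ.filter (fun z => z ≠ x), tl (π₂ z) 0 * μ z x
      = tl (π₂ x) 0 * ∑ y ∈ Finset.univ.filter (fun y => y ≠ x), μ x y := by
    intro x
    have := T₂ x 0
    simp only [Nat.cast_zero, mul_zero, zero_mul, nonpos_iff_eq_zero, one_ne_zero, if_false] at this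
    linarith
  have p₂ := rho_pos hμ (fun x => tl_nonneg (h₂.1 x) 0) r₂ st₂
  have hρ := rho_unique hμ p₂ r₁ r₂ st₁ st₂
  have hw : ∀ x n, 0 ≤ tl (π₂ x) n - tl (π₁ x) n := by
    refine min_principle_s16 hμ (w := fun x n => tl (π₂ x) n - tl (π₁ x) n)
      (d := fun x n => lam * ((n + 1 : ℕ) : ℝ) * (1 - γ * ξ x (n + 1))) p₂ st₂ hk ?_ ?_ ?_ ?_
    · intro x n
      have : 0 ≤ 1 - γ * ξ x (n + 1) := by
        nlinarith [(hξ x (n + 1)).1, (hξ x (n + 1)).2, hγ.1, hγ.2]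
      positivity
    · intro x
      simp [hρ x]
    · intro x
      simpa using (tl_tendsto (π₂ x)).sub (tl_tendsto (π₁ x))
    · intro x n
      have a₁ := T₁ x (n + 1)
      have a₂ := T₂ x (n + 1)
      simp only [Nat.le_add_left, if_true, Nat.add_sub_cancel] at a₁ a₂
      have b₁ := tl_succ (s₁ x) n
      have b₂ := tl_succ (s₂ x) n
      have c₁ := tl_succ (s₁ x) (n + 1)
      have c₂ := tl_succ (s₂ x) (n + 1)
      simp only [sub_mul, Finset.sum_sub_distrib]
      have q₁ : π₁ x n = tl (π₁ x) n - tl (π₁ x) (n + 1) := by linarith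
      have q₂ : π₂ x n = tl (π₂ x) n - tl (π₂ x) (n + 1) := by linarith
      have q₃ : π₁ x (n + 1) = tl (π₁ x) (n + 1) - tl (π₁ x) (n + 2) := by linarith
      have q₄ : π₂ x (n + 1) = tl (π₂ x) (n + 1) - tl (π₂ x) (n + 2) := by linarith
      have hpn : 0 ≤ (κ₂ - κ₁) * π₁ x n := mul_nonneg (by linarith) (h₁.1 x n)
      rw [q₁] at hpn
      rw [q₁, q₃] at a₁
      rw [q₂, q₄] at a₂
      linarith
  have hzero : ∀ n, ∑ x, (tl (π₂ x) (n + 1) - tl (π₁ x) (n + 1)) = 0 := by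
    have := e₂.sub e₁
    rw [sub_self] at this
    simp only [← Finset.sum_sub_distrib] at this
    have h0 := (hasSum_zero_iff_of_nonneg (fun n => Finset.sum_nonneg fun x _ => hw x (n + 1))).1 this
    exact fun n => congrFun h0 n
  have hT : ∀ x n, tl (π₂ x) n = tl (π₁ x) n := by
    intro x n
    cases n with
    | zero => exact (hρ x).symm
    | succ n =>
      have := (Finset.sum_eq_zero_iff_of_nonneg (fun x _ => hw x (n + 1))).1 (hzero n) x
        (Finset.mem_univ x)
      linarith
  have hπ : ∀ x n, π₂ x n = π₁ x n := by
    intro x n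
    have := tl_succ (s₁ x) n
    have := tl_succ (s₂ x) n
    rw [hT, hT] at this
    linarith
  have hz : ∀ x n, π₁ x n = 0 := by
    intro x n
    have a₁ := T₁ x (n + 1)
    have a₂ := T₂ x (n + 1)
    simp only [hT, hπ, Nat.le_add_left, if_true, Nat.add_sub_cancel] at a₁ a₂
    have : (κ₂ - κ₁) * π₁ x n = 0 := by linarith
    exact (mul_eq_zero.1 this).resolve_left (by linarith)
  have := h₁.2.2.1
  simp [hz] at this

lemma limit_sol {μ : Z → Z → ℝ} {lam γ c β κ : ℝ} (hlam : 0 < lam)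
    (hγ : γ ∈ Set.Ioo (0 : ℝ) 1) (hc : 0 ≤ c) {U : Filter ℕ} [U.NeBot]
    {ξs πs : ℕ → Z → ℕ → ℝ} {κs : ℕ → ℝ} {ξ π : Z → ℕ → ℝ}
    (hξ : ∀ k, IsStrategy (ξs k)) (hκ : ∀ k, κs k ≤ c * (lam * (1 - γ)))
    (h : ∀ k, IsProbSolution μ lam γ (κs k) (ξs k) (πs k))
    (hm : ∀ k, (∑' p : Z × ℕ, (p.2 : ℝ) * πs k p.1 p.2) = β)
    (lξ : ∀ z n, Tendsto (fun k => ξs k z n) U (𝓝 (ξ z n)))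
    (lπ : ∀ z n, Tendsto (fun k => πs k z n) U (𝓝 (π z n)))
    (lκ : Tendsto κs U (𝓝 κ)) :
    IsProbSolution μ lam γ κ ξ π ∧ (∑' p : Z × ℕ, (p.2 : ℝ) * π p.1 p.2) = β := by
  have hb := fun k => pois_bound hlam hγ (hξ k) hc (hκ k) (h k)
  have hpos : ∀ z n, 0 ≤ π z n := fun z n => ge_of_tendsto' (lπ z n) fun k => (h k).1 z n
  have hb' : ∀ z n, π z n ≤ c ^ n / n.factorial :=
    fun z n => le_of_tendsto' (lπ z n) fun k => hb k z n
  refine ⟨⟨hpos, ?_, ?_, ?_⟩, ?_⟩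
  · exact Summable.of_nonneg_of_le (fun p => hpos _ _) (fun p => hb' p.1 p.2)
      (summable_pois_prod c hc).2
  · have := tendsto_tsum_of_dominated_convergence (𝓕 := U)
      (f := fun k (p : Z × ℕ) => πs k p.1 p.2) (g := fun p => π p.1 p.2)
      (summable_pois_prod c hc).2 (fun p => lπ p.1 p.2)
      (Eventually.of_forall fun k p => by
        rw [Real.norm_of_nonneg ((h k).1 _ _)]; exact hb k p.1 p.2)
    simp only [(h _).2.2.1] at this
    exact tendsto_nhds_unique this tendsto_const_nhds
  · intro x m
    have e := fun k => (h k).2.2.2 x m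
    have L : Tendsto (fun k => πs k x m * ((∑ y ∈ Finset.univ.filter (fun y => y ≠ x), μ x y) + κs k
        + lam * m * (1 - γ * ξs k x m))) U (𝓝 (π x m * ((∑ y ∈ Finset.univ.filter (fun y => y ≠ x), μ x y) + κ
        + lam * m * (1 - γ * ξ x m)))) :=
      (lπ x m).mul ((lκ.const_add _).add ((((lξ x m).const_mul γ).const_sub 1).const_mul _))
    have hif : Tendsto (fun k => if 1 ≤ m then πs k x (m - 1) else 0) U
        (𝓝 (if 1 ≤ m then π x (m - 1) else 0)) := by
      split_ifs
      · exact lπ _ _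
      · exact tendsto_const_nhds
    refine tendsto_nhds_unique L ?_
    simp only [e]
    exact ((tendsto_finsetSum _ fun z _ => (lπ z m).mul_const _).add (lκ.mul hif)).add
      (((((lξ x (m + 1)).const_mul γ).const_sub 1).const_mul _).mul (lπ x (m + 1)))
  · have := tendsto_tsum_of_dominated_convergence (𝓕 := U)
      (f := fun k (p : Z × ℕ) => (p.2 : ℝ) * πs k p.1 p.2) (g := fun p => (p.2 : ℝ) * π p.1 p.2)
      (summable_pois_prod c hc).1 (fun p => (lπ p.1 p.2).const_mul _)
      (Eventually.of_forall fun k p => by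
        rw [Real.norm_of_nonneg (mul_nonneg (Nat.cast_nonneg _) ((h k).1 _ _))]
        exact mul_le_mul_of_nonneg_left (hb k p.1 p.2) (Nat.cast_nonneg _))
    simp only [hm] at this
    exact tendsto_nhds_unique this tendsto_const_nhds

lemma ultra_lim (U : Ultrafilter ℕ) {a b : ℝ} (f : ℕ → ℝ) (hf : ∀ k, f k ∈ Set.Icc a b) :
    ∃ l ∈ Set.Icc a b, Tendsto f U (𝓝 l) := by
  obtain ⟨l, hl, h⟩ := (isCompact_Icc (a := a) (b := b)).ultrafilter_le_nhds (U.map f)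
    (by rw [le_principal_iff]; exact Filter.mem_map.2 (Filter.univ_mem' hf))
  exact ⟨l, hl, h⟩

end helpers

/-- **Continuity of the equilibrium arrival rate `κ(ξ)`** (Lemma 8 of the paper):
if for each strategy `ξ` the arrival rate `κ(ξ) ∈ [βλ(1-γ), βλ]` is the unique
rate whose stationary distribution has mean `β`, then `ξ ↦ κ(ξ)` is continuous in
the sup-norm on strategies. -/
theorem kappa_continuous (Z : Type) [Fintype Z] [DecidableEq Z] [Nonempty Z]
    (μ : Z → Z → ℝ) (hμ : ∀ z y : Z, z ≠ y → 0 < μ z y)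
    (lam γ β : ℝ) (hlam : 0 < lam) (hγ : γ ∈ Set.Ioo (0 : ℝ) 1) (hβ : 0 < β) :
    ∀ ε : ℝ, 0 < ε → ∃ δ : ℝ, 0 < δ ∧
      ∀ (ξ₁ ξ₂ : Z → ℕ → ℝ) (κ₁ κ₂ : ℝ) (π₁ π₂ : Z → ℕ → ℝ),
        IsStrategy ξ₁ → IsStrategy ξ₂ →
        κ₁ ∈ Set.Icc (β * lam * (1 - γ)) (β * lam) →
        κ₂ ∈ Set.Icc (β * lam * (1 - γ)) (β * lam) →
        IsProbSolution μ lam γ κ₁ ξ₁ π₁ →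
        (∑' p : Z × ℕ, (p.2 : ℝ) * π₁ p.1 p.2) = β →
        IsProbSolution μ lam γ κ₂ ξ₂ π₂ →
        (∑' p : Z × ℕ, (p.2 : ℝ) * π₂ p.1 p.2) = β →
        (⨆ p : Z × ℕ, |ξ₁ p.1 p.2 - ξ₂ p.1 p.2|) < δ →
        |κ₁ - κ₂| < ε := by
  intro ε hε
  by_contra hcon
  push Not at hcon
  have hk1 : ∀ k : ℕ, (0 : ℝ) < 1 / ((k : ℝ) + 1) := fun k => by positivity
  choose ξ₁ ξ₂ κ₁ κ₂ π₁ π₂ hξ₁ hξ₂ hκ₁ hκ₂ h₁ m₁ h₂ m₂ hd hbig using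
    fun k : ℕ => hcon (1 / ((k : ℝ) + 1)) (hk1 k)
  have hg : 0 < 1 - γ := by linarith [hγ.2]
  set c := β / (1 - γ) with hcdef
  have hc : 0 ≤ c := by positivity
  have hcK : c * (lam * (1 - γ)) = β * lam := by rw [hcdef]; field_simp
  set U : Ultrafilter ℕ := Filter.hyperfilter ℕ with hU
  have hUle : (U : Filter ℕ) ≤ atTop := Nat.hyperfilter_le_atTop
  have hp1 : ∀ {κ : ℝ} {ξ π : Z → ℕ → ℝ}, IsProbSolution μ lam γ κ ξ π → ∀ z n,
      π z n ∈ Set.Icc (0 : ℝ) 1 := by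
    intro κ ξ π h z n
    refine ⟨h.1 z n, ?_⟩
    rw [← h.2.2.1]
    exact h.2.1.le_tsum (z, n) (fun p _ => h.1 p.1 p.2)
  choose ξ hξ lξ₁ using fun z n => ultra_lim U (fun k => ξ₁ k z n) (fun k => hξ₁ k z n)
  choose ρ₁ _ lπ₁ using fun z n => ultra_lim U (fun k => π₁ k z n) (fun k => hp1 (h₁ k) z n)
  choose ρ₂ _ lπ₂ using fun z n => ultra_lim U (fun k => π₂ k z n) (fun k => hp1 (h₂ k) z n)
  obtain ⟨l₁, hl₁, lκ₁⟩ := ultra_lim U κ₁ hκ₁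
  obtain ⟨l₂, hl₂, lκ₂⟩ := ultra_lim U κ₂ hκ₂
  have lξ₂ : ∀ z n, Tendsto (fun k => ξ₂ k z n) U (𝓝 (ξ z n)) := by
    intro z n
    have hlim : Tendsto (fun k => ξ₁ k z n - ξ₂ k z n) U (𝓝 0) := by
      refine squeeze_zero_norm (fun k => ?_)
        ((tendsto_one_div_add_atTop_nhds_zero_nat (𝕜 := ℝ)).mono_left hUle)
      refine le_trans ?_ (hd k).le
      refine le_ciSup (f := fun p : Z × ℕ => |ξ₁ k p.1 p.2 - ξ₂ k p.1 p.2|) ?_ (z, n)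
      refine ⟨1, ?_⟩
      rintro _ ⟨p, rfl⟩
      have a := hξ₁ k p.1 p.2
      have b := hξ₂ k p.1 p.2
      exact abs_le.2 ⟨by linarith [a.1, b.2], by linarith [a.2, b.1]⟩
    have := (lξ₁ z n).sub hlim
    simpa using this
  obtain ⟨s₁, n₁⟩ := limit_sol hlam hγ hc hξ₁ (fun k => hcK ▸ (hκ₁ k).2) h₁ m₁ lξ₁ lπ₁ lκ₁
  obtain ⟨s₂, n₂⟩ := limit_sol hlam hγ hc hξ₂ (fun k => hcK ▸ (hκ₂ k).2) h₂ m₂ lξ₂ lπ₂ lκ₂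
  have hgap : ε ≤ |l₁ - l₂| := ge_of_tendsto' (lκ₁.sub lκ₂).abs hbig
  have hlow : 0 < β * lam * (1 - γ) := by positivity
  rcases lt_trichotomy l₁ l₂ with h | h | h
  · exact unique_aux hμ hlam hγ hξ hc (hcK ▸ hl₁.2) (hcK ▸ hl₂.2) (hlow.trans_le hl₂.1) h
      s₁ s₂ n₁ n₂
  · rw [h, sub_self, abs_zero] at hgap
    linarith
  · exact unique_aux hμ hlam hγ hξ hc (hcK ▸ hl₂.2) (hcK ▸ hl₁.2) (hlow.trans_le hl₁.1) h
      s₂ s₁ n₂ n₁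
end
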